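/- Let A = (A_1,…,A_κ) ∈ SL₂(ℝ)^κ and let p be a probability vector with all p_i > 0 such that L(p,A) > 0. Then there exists an open neighborhood of p inside the open simplex Δ = {q ∈ ℝ^κ : q_i > 0 for all i, Σ_i q_i = 1} on which the function q ↦ L(q,A) is real analytic. (Peres' theorem.) -/

import Mathlib

open MeasureTheory

noncomputable section

abbrev Mat2 : Type := Matrix (Fin 2) (Fin 2) ℝ
abbrev SL2 : Type := Matrix.SpecialLinearGroup (Fin 2) ℝ
abbrev E2 : Type := EuclideanSpace ℝ (Fin 2)
abbrev Pone : Type := Projectivization ℝ E2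

instance : TopologicalSpace SL2 :=
  inferInstanceAs (TopologicalSpace { A : Mat2 // A.det = 1 })

/-- The operator norm of a 2×2 real matrix, acting on Euclidean ℝ². -/
def opNorm (M : Mat2) : ℝ := ‖Matrix.toEuclideanCLM (𝕜 := ℝ) M‖

/-- The continuous linear map on Euclidean ℝ² induced by a matrix in SL₂(ℝ). -/
def toEuc (g : SL2) : E2 →L[ℝ] E2 := Matrix.toEuclideanCLM (𝕜 := ℝ) (g : Mat2)

lemma toEuc_injective (g : SL2) : Function.Injective (toEuc g) := by
  intro x y hxy
  have key : ∀ z, toEuc g⁻¹ (toEuc g z) = z := by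
    intro z
    have h1 : ((g⁻¹ : SL2) : Mat2) * (g : Mat2) = 1 := by
      rw [← Matrix.SpecialLinearGroup.coe_mul, inv_mul_cancel,
        Matrix.SpecialLinearGroup.coe_one]
    calc toEuc g⁻¹ (toEuc g z)
        = (Matrix.toEuclideanCLM (𝕜 := ℝ) (((g⁻¹ : SL2) : Mat2) * (g : Mat2))) z := by
          rw [map_mul]; rfl
      _ = z := by rw [h1, map_one]; rfl
  have := congrArg (toEuc g⁻¹) hxy
  rwa [key, key] at this

/-- The projective action of SL₂(ℝ) on the real projective line ℙ¹. -/
def pact (g : SL2) : Pone → Pone :=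
  Projectivization.map (toEuc g).toLinearMap (toEuc_injective g)

instance : MeasurableSpace Pone :=
  inferInstanceAs (MeasurableSpace (Quotient (projectivizationSetoid ℝ E2)))

instance : TopologicalSpace Pone :=
  inferInstanceAs (TopologicalSpace (Quotient (projectivizationSetoid ℝ E2)))

/-- The ordered product `A_{w_{n-1}} ⋯ A_{w_1} A_{w_0}` of the matrices along a word `w`. -/
def wordProd {κ : ℕ} (A : Fin κ → SL2) {n : ℕ} (w : Fin n → Fin κ) : SL2 :=
  (List.ofFn fun i => A (w i)).reverse.prod

/-- The Lyapunov exponent of the random product of the matrices `A_1, …, A_κ` with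
probabilities `p_1, …, p_κ`:
`L(p,A) = inf_{n ≥ 1} (1/n) ∫_Σ log‖A^n(x)‖ dμ_p(x) = inf_{n ≥ 1} (1/n) Σ_w p(w) log‖A_w‖`,
the integral over the Bernoulli measure `μ_p = p^ℤ` being a finite sum over words of
length `n` since the cocycle is locally constant. -/
def lyapLC {κ : ℕ} (p : Fin κ → ℝ) (A : Fin κ → SL2) : ℝ :=
  ⨅ n : {m : ℕ // 0 < m},
    (((n : ℕ) : ℝ))⁻¹ * ∑ w : Fin (n : ℕ) → Fin κ,
      (∏ i, p (w i)) * Real.log (opNorm ((wordProd A w : SL2) : Mat2))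

/-- The distance `‖B₁ − B₂‖` on tuples of matrices (sup of the operator norms of the
differences of the components). -/
def tdist {κ : ℕ} (B₁ B₂ : Fin κ → SL2) : ℝ :=
  ⨆ i, opNorm ((B₁ i : Mat2) - (B₂ i : Mat2))

/-! ### Expectations over words -/

/-- Expectation of `h(A_w)` over random words `w` of length `n`, defined recursively. -/
def EW {κ : ℕ} (q : Fin κ → ℝ) (A : Fin κ → SL2) : ℕ → (SL2 → ℝ) → ℝ
  | 0, h => h 1
  | n + 1, h => ∑ i, q i * EW q A n (fun B => h (B * A i))

lemma wordProd_cons {κ : ℕ} (A : Fin κ → SL2) {n : ℕ} (i : Fin κ) (w : Fin n → Fin κ) :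
    wordProd A (Fin.cons i w : Fin (n+1) → Fin κ) = wordProd A w * A i := by
  simp [wordProd, List.ofFn_succ]

lemma EW_eq {κ : ℕ} (q : Fin κ → ℝ) (A : Fin κ → SL2) (n : ℕ) (h : SL2 → ℝ) :
    EW q A n h = ∑ w : Fin n → Fin κ, (∏ i, q (w i)) * h (wordProd A w) := by
  induction n generalizing h with
  | zero => simp [EW, wordProd]
  | succ n ih =>
    rw [EW, ← (Fin.consEquiv (fun _ => Fin κ)).sum_comp, Fintype.sum_prod_type]
    refine Finset.sum_congr rfl fun i _ => ?_
    rw [ih, Finset.mul_sum]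
    refine Finset.sum_congr rfl fun w _ => ?_
    have : (Fin.consEquiv (fun _ => Fin κ)) (i, w) = (Fin.cons i w : Fin (n+1) → Fin κ) := rfl
    rw [this, wordProd_cons, Fin.prod_univ_succ]
    simp [mul_assoc]

lemma EW_add {κ : ℕ} (q : Fin κ → ℝ) (A : Fin κ → SL2) (n : ℕ) (h k : SL2 → ℝ) :
    EW q A n (fun B => h B + k B) = EW q A n h + EW q A n k := by
  induction n generalizing h k with
  | zero => simp [EW]
  | succ n ih =>
    simp only [EW]
    rw [← Finset.sum_add_distrib]
    refine Finset.sum_congr rfl fun i _ => ?_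
    rw [ih, mul_add]

lemma EW_mul {κ : ℕ} (q : Fin κ → ℝ) (A : Fin κ → SL2) (n : ℕ) (c : ℝ) (h : SL2 → ℝ) :
    EW q A n (fun B => c * h B) = c * EW q A n h := by
  induction n generalizing h with
  | zero => simp [EW]
  | succ n ih =>
    simp only [EW]
    rw [Finset.mul_sum]
    refine Finset.sum_congr rfl fun i _ => ?_
    rw [ih]; ring

lemma EW_sum {κ : ℕ} (q : Fin κ → ℝ) (A : Fin κ → SL2) (n : ℕ) {ι : Type*} (s : Finset ι)
    (h : ι → SL2 → ℝ) :
    EW q A n (fun B => ∑ j ∈ s, h j B) = ∑ j ∈ s, EW q A n (h j) := by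
  classical
  induction s using Finset.induction_on with
  | empty =>
    simp only [Finset.sum_empty]
    simpa using EW_mul q A n 0 (fun _ => 0)
  | insert a s ha ih =>
    simp only [Finset.sum_insert ha]
    rw [EW_add, ih]

lemma EW_mono {κ : ℕ} (q : Fin κ → ℝ) (hq : ∀ i, 0 < q i) (A : Fin κ → SL2) (n : ℕ)
    {h k : SL2 → ℝ} (hk : ∀ B, h B ≤ k B) : EW q A n h ≤ EW q A n k := by
  induction n generalizing h k with
  | zero => simpa [EW] using hk 1
  | succ n ih =>
    simp only [EW]
    exact Finset.sum_le_sum fun i _ =>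
      mul_le_mul_of_nonneg_left (ih fun B => hk _) (hq i).le

lemma EW_const {κ : ℕ} (q : Fin κ → ℝ) (hq1 : ∑ i, q i = 1) (A : Fin κ → SL2) (n : ℕ) (c : ℝ) :
    EW q A n (fun _ => c) = c := by
  induction n with
  | zero => simp [EW]
  | succ n ih =>
    simp only [EW, ih]
    rw [← Finset.sum_mul, hq1, one_mul]

lemma EW_comp {κ : ℕ} (q : Fin κ → ℝ) (A : Fin κ → SL2) (m n : ℕ) (h : SL2 → ℝ) :
    EW q A (m + n) h = EW q A n (fun B => EW q A m (fun C => h (C * B))) := by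
  induction n generalizing h with
  | zero => simp [EW]
  | succ n ih =>
    rw [← add_assoc, EW, EW]
    refine Finset.sum_congr rfl fun i _ => ?_
    rw [ih]
    simp only [mul_assoc]

lemma EW_left {κ : ℕ} (q : Fin κ → ℝ) (A : Fin κ → SL2) (n : ℕ) (h : SL2 → ℝ) :
    EW q A (n + 1) h = EW q A n (fun B => ∑ i, q i * h (A i * B)) := by
  rw [add_comm, EW_comp]
  simp [EW]

/-! ### Norms and wedge -/

lemma toEuc_mul (g h : SL2) (x : E2) : toEuc (g * h) x = toEuc g (toEuc h x) := by
  unfold toEuc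
  rw [Matrix.SpecialLinearGroup.coe_mul, map_mul]; rfl

lemma toEuc_one (x : E2) : toEuc 1 x = x := by
  unfold toEuc
  rw [Matrix.SpecialLinearGroup.coe_one, map_one]; rfl

lemma toEuc_apply (g : SL2) (x : E2) (i : Fin 2) :
    toEuc g x i = g.1 i 0 * x 0 + g.1 i 1 * x 1 := by
  simp [toEuc, Matrix.mulVec, dotProduct, Fin.sum_univ_two]

lemma nsq (x : E2) : ‖x‖ ^ 2 = x 0 ^ 2 + x 1 ^ 2 := by
  rw [EuclideanSpace.norm_sq_eq]; simp [Fin.sum_univ_two]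

def wd (x y : E2) : ℝ := x 0 * y 1 - x 1 * y 0

lemma det_eq (g : SL2) : g.1 0 0 * g.1 1 1 - g.1 0 1 * g.1 1 0 = 1 := by
  have := g.2
  rwa [Matrix.det_fin_two] at this

lemma wd_act (g : SL2) (x y : E2) : wd (toEuc g x) (toEuc g y) = wd x y := by
  have := det_eq g
  simp only [wd, toEuc_apply]
  linear_combination (x 0 * y 1 - x 1 * y 0) * this

lemma wd_le (x y : E2) : |wd x y| ≤ ‖x‖ * ‖y‖ := by
  apply abs_le_of_sq_le_sq _ (by positivity)
  rw [mul_pow, nsq, nsq, wd]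
  nlinarith [sq_nonneg (x 0 * y 0 + x 1 * y 1)]

/-- rotation by a right angle -/
def rot (x : E2) : E2 := !₂[- x 1, x 0]

lemma rot_norm (x : E2) : ‖rot x‖ = ‖x‖ := by
  have : ‖rot x‖ ^ 2 = ‖x‖ ^ 2 := by
    rw [nsq, nsq]; simp [rot]; ring
  exact (sq_eq_sq₀ (norm_nonneg _) (norm_nonneg _)).1 this

lemma wd_rot (x : E2) : wd x (rot x) = ‖x‖ ^ 2 := by
  rw [nsq]; simp [wd, rot]; ring

lemma opNorm_eq (g : SL2) : opNorm (g : Mat2) = ‖toEuc g‖ := rfl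

lemma act_le (g : SL2) (x : E2) : ‖toEuc g x‖ ≤ ‖toEuc g‖ * ‖x‖ := (toEuc g).le_opNorm x

lemma le_act (g : SL2) (x : E2) : ‖x‖ ≤ ‖toEuc g‖ * ‖toEuc g x‖ := by
  by_cases hx : x = 0
  · subst hx; simp
  have hx' : 0 < ‖x‖ := norm_pos_iff.2 hx
  have h1 := wd_le (toEuc g x) (toEuc g (rot x))
  rw [wd_act, wd_rot, abs_of_nonneg (by positivity)] at h1
  have h2 := act_le g (rot x)
  rw [rot_norm] at h2
  have h3 : ‖x‖ * ‖x‖ ≤ (‖toEuc g‖ * ‖toEuc g x‖) * ‖x‖ := by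
    nlinarith [norm_nonneg (toEuc g x)]
  exact le_of_mul_le_mul_right h3 hx'

lemma one_le_norm (g : SL2) : 1 ≤ ‖toEuc g‖ := by
  let x : E2 := !₂[1, 0]
  have hx : ‖x‖ = 1 := by
    have : ‖x‖ ^ 2 = 1 := by rw [nsq]; simp [x]
    nlinarith [norm_nonneg x]
  have h1 := le_act g x
  have h2 := act_le g x
  rw [hx] at h1 h2
  nlinarith [norm_nonneg (toEuc g), norm_nonneg (toEuc g x)]

lemma sl_norm_mul_le (g h : SL2) : ‖toEuc (g * h)‖ ≤ ‖toEuc g‖ * ‖toEuc h‖ := by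
  have : toEuc (g * h) = (toEuc g).comp (toEuc h) := by
    ext1 x; exact toEuc_mul g h x
  rw [this]; exact ContinuousLinearMap.opNorm_comp_le _ _

def e1 : E2 := !₂[1, 0]
def e2 : E2 := !₂[0, 1]

lemma norm_le_cols (g : SL2) : ‖toEuc g‖ ≤ ‖toEuc g e1‖ + ‖toEuc g e2‖ := by
  refine ContinuousLinearMap.opNorm_le_bound _ (by positivity) fun x => ?_
  have : x = x 0 • e1 + x 1 • e2 := by
    ext i; fin_cases i <;> simp [e1, e2]
  have h0 : |x 0| ≤ ‖x‖ := by
    apply abs_le_of_sq_le_sq _ (norm_nonneg _); rw [nsq]; nlinarith [sq_nonneg (x 1)]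
  have h1 : |x 1| ≤ ‖x‖ := by
    apply abs_le_of_sq_le_sq _ (norm_nonneg _); rw [nsq]; nlinarith [sq_nonneg (x 0)]
  calc ‖toEuc g x‖ = ‖x 0 • toEuc g e1 + x 1 • toEuc g e2‖ := by
        conv_lhs => rw [this]
        simp
    _ ≤ |x 0| * ‖toEuc g e1‖ + |x 1| * ‖toEuc g e2‖ := by
        refine (norm_add_le _ _).trans ?_
        rw [norm_smul, norm_smul]; simp
    _ ≤ _ := by nlinarith [norm_nonneg (toEuc g e1), norm_nonneg (toEuc g e2)]

/-- An almost most contracted direction. -/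
lemma exists_contr (g : SL2) : ∃ s : E2, s ≠ 0 ∧
    ∀ x, ‖toEuc g‖ * |wd x s| ≤ 2 * (‖toEuc g x‖ * ‖s‖) := by
  -- it suffices to find `s` with `‖g‖ ‖g s‖ ≤ 2 ‖s‖`
  suffices h : ∃ s : E2, s ≠ 0 ∧ ‖toEuc g‖ * ‖toEuc g s‖ ≤ 2 * ‖s‖ by
    obtain ⟨s, hs, h⟩ := h
    refine ⟨s, hs, fun x => ?_⟩
    have h1 := wd_le (toEuc g x) (toEuc g s)
    rw [wd_act] at h1
    nlinarith [norm_nonneg (toEuc g x), norm_nonneg (toEuc g)]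
  have hdet := det_eq g
  set a := g.1 0 0
  set b := g.1 0 1
  set c := g.1 1 0
  set d := g.1 1 1
  have hn : ‖toEuc g‖ ^ 2 ≤ 2 * (a^2+b^2+c^2+d^2) := by
    have h := norm_le_cols g
    have e1' : ‖toEuc g e1‖ ^ 2 = a^2 + c^2 := by
      rw [nsq, toEuc_apply, toEuc_apply]; simp [e1, a, c]
    have e2' : ‖toEuc g e2‖ ^ 2 = b^2 + d^2 := by
      rw [nsq, toEuc_apply, toEuc_apply]; simp [e2, b, d]
    have : ‖toEuc g‖ ^ 2 ≤ (‖toEuc g e1‖ + ‖toEuc g e2‖)^2 := by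
      gcongr
    nlinarith [sq_nonneg (‖toEuc g e1‖ - ‖toEuc g e2‖)]
  have key : ∀ s : E2, 0 < ‖s‖ → ‖toEuc g s‖ = 1 → (a^2+b^2+c^2+d^2) ≤ 2 * ‖s‖^2 →
      s ≠ 0 ∧ ‖toEuc g‖ * ‖toEuc g s‖ ≤ 2 * ‖s‖ := by
    intro s hs h1 h2
    refine ⟨norm_pos_iff.1 hs, ?_⟩
    rw [h1, mul_one]
    refine (le_abs_self _).trans (abs_le_of_sq_le_sq ?_ (by positivity))
    nlinarith
  rcases le_total (c^2+d^2) (a^2+b^2) with h | h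
  · let s : E2 := !₂[-b, a]
    have hs2 : ‖s‖ ^ 2 = a^2 + b^2 := by rw [nsq]; simp [s]; ring
    have hgs : ‖toEuc g s‖ = 1 := by
      have : ‖toEuc g s‖ ^ 2 = 1 := by
        rw [nsq, toEuc_apply, toEuc_apply]
        change (a * (-b) + b * a)^2 + (c * (-b) + d * a)^2 = 1
        have : c * (-b) + d * a = 1 := by linarith
        rw [this]; ring
      nlinarith [norm_nonneg (toEuc g s)]
    refine ⟨s, key s ?_ hgs (by linarith)⟩
    rcases (norm_nonneg s).lt_or_eq with h0 | h0
    · exact h0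
    · rw [norm_eq_zero.1 h0.symm] at hgs; simp at hgs
  · let s : E2 := !₂[-d, c]
    have hs2 : ‖s‖ ^ 2 = c^2 + d^2 := by rw [nsq]; simp [s]; ring
    have hgs : ‖toEuc g s‖ = 1 := by
      have : ‖toEuc g s‖ ^ 2 = 1 := by
        rw [nsq, toEuc_apply, toEuc_apply]
        change (a * (-d) + b * c)^2 + (c * (-d) + d * c)^2 = 1
        have : a * (-d) + b * c = -1 := by linarith
        rw [this]; ring
      nlinarith [norm_nonneg (toEuc g s)]
    refine ⟨s, key s ?_ hgs (by linarith)⟩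
    rcases (norm_nonneg s).lt_or_eq with h0 | h0
    · exact h0
    · rw [norm_eq_zero.1 h0.symm] at hgs; simp at hgs
/-! ### Basic properties of the Lyapunov exponent -/

/-- `E log ‖A^n‖` -/
def aN {κ : ℕ} (q : Fin κ → ℝ) (A : Fin κ → SL2) (n : ℕ) : ℝ :=
  EW q A n (fun B => Real.log ‖toEuc B‖)

lemma lyap_eq {κ : ℕ} (q : Fin κ → ℝ) (A : Fin κ → SL2) :
    lyapLC q A = ⨅ n : {m : ℕ // 0 < m}, (((n : ℕ) : ℝ))⁻¹ * aN q A n := by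
  unfold lyapLC aN
  congr 1
  ext n
  rw [EW_eq]
  rfl

section
variable {κ : ℕ} {q : Fin κ → ℝ} (hq : ∀ i, 0 < q i) (hq1 : ∑ i, q i = 1) (A : Fin κ → SL2)

lemma log_norm_nonneg (B : SL2) : 0 ≤ Real.log ‖toEuc B‖ := Real.log_nonneg (one_le_norm B)

include hq hq1

lemma aN_nonneg (n : ℕ) : 0 ≤ aN q A n := by
  have := EW_mono q hq A n (h := fun _ => 0) (k := fun B => Real.log ‖toEuc B‖) log_norm_nonneg
  rwa [EW_const q hq1] at this

lemma aN_sub (m n : ℕ) : aN q A (m + n) ≤ aN q A m + aN q A n := by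
  unfold aN
  rw [EW_comp]
  calc EW q A n (fun B => EW q A m fun C => Real.log ‖toEuc (C * B)‖)
      ≤ EW q A n (fun B => EW q A m (fun C => Real.log ‖toEuc C‖) + Real.log ‖toEuc B‖) := by
        refine EW_mono q hq A n fun B => ?_
        have h2 : EW q A m (fun C => Real.log ‖toEuc C‖ + Real.log ‖toEuc B‖)
          = EW q A m (fun C => Real.log ‖toEuc C‖) + Real.log ‖toEuc B‖ := by
          rw [EW_add, EW_const q hq1]
        rw [← h2]
        refine EW_mono q hq A m fun C => ?_
        have hB := one_le_norm B
        have hC := one_le_norm C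
        have hCB := one_le_norm (C * B)
        rw [← Real.log_mul (by positivity) (by positivity)]
        exact Real.log_le_log (by positivity) (sl_norm_mul_le C B)
    _ = _ := by rw [EW_add, EW_const q hq1]

lemma aN_mul (k n : ℕ) : aN q A (k * n) ≤ k * aN q A n := by
  induction k with
  | zero => simp [aN, EW]; 
            have : toEuc 1 = ContinuousLinearMap.id ℝ E2 := by ext1 x; exact toEuc_one x
            rw [this]; simp
  | succ k ih =>
    rw [Nat.succ_mul]
    refine (aN_sub hq hq1 A _ _).trans ?_
    push_cast; linarith

lemma lyap_le_aN (n : ℕ) (hn : 0 < n) : n * lyapLC q A ≤ aN q A n := by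
  have h : lyapLC q A ≤ (n : ℝ)⁻¹ * aN q A n := by
    rw [lyap_eq]
    refine ciInf_le ⟨0, ?_⟩ (⟨n, hn⟩ : {m : ℕ // 0 < m})
    rintro _ ⟨m, rfl⟩
    exact mul_nonneg (by positivity) (aN_nonneg hq hq1 A m)
  have hn' : (0 : ℝ) < n := by exact_mod_cast hn
  calc (n : ℝ) * lyapLC q A ≤ n * ((n : ℝ)⁻¹ * aN q A n) := by gcongr
    _ = _ := by field_simp

lemma le_lyap {c C : ℝ} (h : ∀ n, n * c - C ≤ aN q A n) : c ≤ lyapLC q A := by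
  rw [lyap_eq]
  have : Nonempty {m : ℕ // 0 < m} := ⟨⟨1, one_pos⟩⟩
  refine le_ciInf fun n => ?_
  have hn' : (0 : ℝ) < ((n : ℕ) : ℝ) := by exact_mod_cast n.2
  rw [inv_mul_eq_div, le_div_iff₀ hn']
  refine le_of_forall_pos_lt_add fun ε hε => ?_
  obtain ⟨k, hk⟩ := exists_nat_gt (C / ε)
  have h1 := h ((k+1) * n)
  have h2 := aN_mul hq hq1 A (k+1) n
  push_cast at h1 h2
  rw [div_lt_iff₀ hε] at hk
  have hk0 : (0:ℝ) < (k:ℝ) + 1 := by positivity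
  by_contra hcon
  push Not at hcon
  nlinarith

lemma lyap_le {c C : ℝ} (h : ∀ n, aN q A n ≤ n * c + C) : lyapLC q A ≤ c := by
  refine le_of_forall_pos_lt_add fun ε hε => ?_
  obtain ⟨k, hk⟩ := exists_nat_gt (C / ε)
  have h1 := h (k + 1)
  have h2 := lyap_le_aN hq hq1 A (k+1) (Nat.succ_pos _)
  rw [div_lt_iff₀ hε] at hk
  push_cast at h1 h2
  have hk0 : (0:ℝ) < (k:ℝ) + 1 := by positivity
  by_contra hcon
  push Not at hcon
  nlinarith

/-- Upper bound via a Lyapunov function. -/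
lemma lyap_le_of_super {s : E2 → ℝ} {α lam K : ℝ} (hα : 0 < α) (hα1 : α ≤ 1) (hlam : 0 < lam)
    (hK : ∀ z, ‖z‖ ^ α ≤ K * s z)
    (hs : ∀ z, ∑ i, q i * s (toEuc (A i) z) ≤ lam * s z) (hK0 : 0 ≤ K) :
    lyapLC q A ≤ α⁻¹ * Real.log lam := by
  have hE : ∀ (n : ℕ) (z : E2), EW q A n (fun B => s (toEuc B z)) ≤ lam ^ n * s z := by
    intro n
    induction n with
    | zero => intro z; simp [EW, toEuc_one]
    | succ n ih =>
      intro z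
      rw [EW_left]
      calc EW q A n (fun B => ∑ i, q i * s (toEuc (A i * B) z))
          ≤ EW q A n (fun B => lam * s (toEuc B z)) := by
            refine EW_mono q hq A n fun B => ?_
            simp only [toEuc_mul]
            exact hs _
        _ ≤ lam * (lam ^ n * s z) := by
            rw [EW_mul]
            exact mul_le_mul_of_nonneg_left (ih z) hlam.le
        _ = _ := by ring
  refine lyap_le hq hq1 A (C := α⁻¹ * (K * (s e1 + s e2))) fun n => ?_
  have hln : 0 < lam ^ n := by positivity
  calc aN q A n ≤ EW q A n (fun B => (α⁻¹ * (n * Real.log lam)) + (α⁻¹ * ((lam ^ n)⁻¹ * K)) *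
          (s (toEuc B e1) + s (toEuc B e2))) := by
        refine EW_mono q hq A n fun B => ?_
        have hB : 0 < ‖toEuc B‖ := by linarith [one_le_norm B]
        have h1 : ‖toEuc B‖ ^ α ≤ K * (s (toEuc B e1) + s (toEuc B e2)) := by
          calc ‖toEuc B‖ ^ α ≤ (‖toEuc B e1‖ + ‖toEuc B e2‖) ^ α :=
                Real.rpow_le_rpow (norm_nonneg _) (norm_le_cols B) hα.le
            _ ≤ ‖toEuc B e1‖ ^ α + ‖toEuc B e2‖ ^ α :=
                Real.rpow_add_le_add_rpow (norm_nonneg _) (norm_nonneg _) hα.le hα1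
            _ ≤ _ := by linarith [hK (toEuc B e1), hK (toEuc B e2)]
        have hBa : 0 < ‖toEuc B‖ ^ α := by positivity
        have h2 := Real.log_le_sub_one_of_pos (x := ‖toEuc B‖ ^ α / lam ^ n) (by positivity)
        rw [Real.log_div hBa.ne' hln.ne', Real.log_rpow hB, Real.log_pow] at h2
        have h3 : ‖toEuc B‖ ^ α / lam ^ n ≤
            (lam ^ n)⁻¹ * (K * (s (toEuc B e1) + s (toEuc B e2))) := by
          rw [div_eq_inv_mul]; gcongr
        have h4 : α * Real.log ‖toEuc B‖ ≤ n * Real.log lam +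
            (lam ^ n)⁻¹ * (K * (s (toEuc B e1) + s (toEuc B e2))) := by linarith
        calc Real.log ‖toEuc B‖ = α⁻¹ * (α * Real.log ‖toEuc B‖) := by field_simp
          _ ≤ α⁻¹ * (n * Real.log lam +
            (lam ^ n)⁻¹ * (K * (s (toEuc B e1) + s (toEuc B e2)))) := by gcongr
          _ = _ := by ring
    _ = α⁻¹ * (n * Real.log lam) + (α⁻¹ * ((lam ^ n)⁻¹ * K)) *
          (EW q A n (fun B => s (toEuc B e1)) + EW q A n (fun B => s (toEuc B e2))) := by
        rw [EW_add, EW_const q hq1, EW_mul, EW_add]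
    _ ≤ α⁻¹ * (n * Real.log lam) + (α⁻¹ * ((lam ^ n)⁻¹ * K)) *
          (lam ^ n * s e1 + lam ^ n * s e2) := by
        have := hE n e1
        have := hE n e2
        gcongr
    _ = _ := by field_simp
end
/-! ### Reducible cases -/

lemma exp_second_order {κ : ℕ} (q : Fin κ → ℝ) (hq : ∀ i, 0 < q i) (hq1 : ∑ i, q i = 1)
    (l : Fin κ → ℝ) :
    ∃ K α₀ : ℝ, 0 ≤ K ∧ 0 < α₀ ∧ α₀ ≤ 1 ∧ ∀ α : ℝ, |α| ≤ α₀ →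
      ∑ i, q i * Real.exp (α * l i) ≤ 1 + α * ∑ i, q i * l i + K * α ^ 2 := by
  refine ⟨∑ i, q i * (l i) ^ 2, (1 + ∑ i, |l i|)⁻¹, ?_, ?_, ?_, ?_⟩
  · exact Finset.sum_nonneg fun i _ => mul_nonneg (hq i).le (sq_nonneg _)
  · have : 0 ≤ ∑ i, |l i| := Finset.sum_nonneg fun i _ => abs_nonneg _
    positivity
  · have : 0 ≤ ∑ i, |l i| := Finset.sum_nonneg fun i _ => abs_nonneg _
    exact inv_le_one_of_one_le₀ (by linarith)
  · intro α hα
    have h0 : 0 ≤ ∑ i, |l i| := Finset.sum_nonneg fun i _ => abs_nonneg _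
    have key : ∀ i, q i * Real.exp (α * l i) ≤ q i + α * (q i * l i) + (q i * (l i)^2) * α ^ 2 := by
      intro i
      have h1 : |l i| ≤ 1 + ∑ i, |l i| := by
        have := Finset.single_le_sum (f := fun i => |l i|) (fun i _ => abs_nonneg _)
          (Finset.mem_univ i)

        linarith
      have h2 : |α * l i| ≤ 1 := by
        rw [abs_mul]
        calc |α| * |l i| ≤ (1 + ∑ i, |l i|)⁻¹ * (1 + ∑ i, |l i|) := by gcongr
          _ = 1 := by field_simp
      have h3 := Real.abs_exp_sub_one_sub_id_le h2
      have h4 := (abs_le.1 h3).2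
      have h5 := mul_le_mul_of_nonneg_left h4 (hq i).le
      nlinarith
    calc ∑ i, q i * Real.exp (α * l i)
        ≤ ∑ i, (q i + α * (q i * l i) + (q i * (l i)^2) * α ^ 2) :=
          Finset.sum_le_sum fun i _ => key i
      _ = _ := by
        rw [Finset.sum_add_distrib, Finset.sum_add_distrib, hq1, ← Finset.mul_sum, ← Finset.sum_mul]

lemma cramer (v v' z : E2) : wd v v' • z = wd z v' • v + wd v z • v' := by
  ext i; fin_cases i <;> simp [wd] <;> ring

lemma wd_smul_left (c : ℝ) (x y : E2) : wd (c • x) y = c * wd x y := by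
  simp [wd]; ring
lemma wd_smul_right (c : ℝ) (x y : E2) : wd x (c • y) = c * wd x y := by
  simp [wd]; ring
lemma wd_add_left (x x' y : E2) : wd (x + x') y = wd x y + wd x' y := by
  simp [wd]; ring
lemma wd_swap (x y : E2) : wd x y = - wd y x := by
  simp only [wd]; ring
lemma wd_self (x : E2) : wd x x = 0 := by
  simp [wd]; ring

lemma parallel_of_wd {v x : E2} (hv : v ≠ 0) (h : wd x v = 0) : ∃ c : ℝ, x = c • v := by
  have h1 := cramer v (rot v) x
  rw [wd_rot] at h1
  have hv' : ‖v‖ ≠ 0 := norm_ne_zero_iff.2 hv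
  have h3 : wd v x = 0 := by rw [wd_swap, h, neg_zero]
  rw [h3, zero_smul, add_zero] at h1
  refine ⟨(‖v‖^2)⁻¹ * wd x (rot v), ?_⟩
  rw [mul_smul, ← h1, smul_smul, inv_mul_cancel₀ (by positivity), one_smul]

lemma act_ne_zero (g : SL2) {x : E2} (hx : x ≠ 0) : toEuc g x ≠ 0 := by
  intro h
  apply hx
  exact toEuc_injective g (by rw [h, map_zero])

lemma norm_rpow_le_coord {v v' : E2} (hD : wd v v' ≠ 0) {α : ℝ} (hα : 0 < α) (hα1 : α ≤ 1) :
    ∃ K : ℝ, 0 ≤ K ∧ ∀ z, ‖z‖ ^ α ≤ K * (|wd z v'| ^ α + |wd v z| ^ α) := by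
  have hD' : 0 < |wd v v'| := abs_pos.2 hD
  refine ⟨((‖v‖ + ‖v'‖) / |wd v v'|) ^ α, by positivity, fun z => ?_⟩
  have h1 : |wd v v'| * ‖z‖ ≤ (‖v‖ + ‖v'‖) * (|wd z v'| + |wd v z|) := by
    rw [← Real.norm_eq_abs, ← norm_smul, cramer]
    refine (norm_add_le _ _).trans ?_
    rw [norm_smul, norm_smul, Real.norm_eq_abs, Real.norm_eq_abs]
    nlinarith [abs_nonneg (wd z v'), abs_nonneg (wd v z), norm_nonneg v, norm_nonneg v',
      mul_nonneg (abs_nonneg (wd z v')) (norm_nonneg v'),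
      mul_nonneg (abs_nonneg (wd v z)) (norm_nonneg v)]
  have h2 : ‖z‖ ≤ ((‖v‖ + ‖v'‖) / |wd v v'|) * (|wd z v'| + |wd v z|) := by
    rw [div_mul_eq_mul_div, le_div_iff₀ hD']; linarith
  calc ‖z‖ ^ α ≤ (((‖v‖ + ‖v'‖) / |wd v v'|) * (|wd z v'| + |wd v z|)) ^ α :=
        Real.rpow_le_rpow (norm_nonneg _) h2 hα.le
    _ = ((‖v‖ + ‖v'‖) / |wd v v'|) ^ α * (|wd z v'| + |wd v z|) ^ α :=
        Real.mul_rpow (by positivity) (by positivity)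
    _ ≤ _ := by
        gcongr
        exact Real.rpow_add_le_add_rpow (abs_nonneg _) (abs_nonneg _) hα.le hα1

lemma rpow_exp {a : ℝ} (ha : a ≠ 0) (α : ℝ) : |a| ^ α = Real.exp (α * Real.log |a|) := by
  rw [Real.rpow_def_of_pos (abs_pos.2 ha), mul_comm]

section
variable {κ : ℕ} {q : Fin κ → ℝ} (hq : ∀ i, 0 < q i) (hq1 : ∑ i, q i = 1) (A : Fin κ → SL2)
include hq hq1

lemma line_upper {v : E2} (hv : v ≠ 0) (a : Fin κ → ℝ) (ha : ∀ i, a i ≠ 0)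
    (hav : ∀ i, toEuc (A i) v = a i • v) :
    lyapLC q A ≤ |∑ i, q i * Real.log (|a i|)| := by
  set m := |∑ i, q i * Real.log (|a i|)| with hm
  obtain ⟨K, α₀, hK, hα₀, hα₀1, hexp⟩ := exp_second_order q hq hq1 (fun i => Real.log |a i|)
  have main : ∀ α, 0 < α → α ≤ α₀ → lyapLC q A ≤ m + (K + 1) * α := by
    intro α hα hαα
    have hα1 : α ≤ 1 := hαα.trans hα₀1
    have hD : wd v (rot v) ≠ 0 := by
      rw [wd_rot]; exact pow_ne_zero _ (norm_ne_zero_iff.2 hv)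
    set v' := rot v with hv'
    obtain ⟨C, hC, hcoord⟩ := norm_rpow_le_coord hD hα hα1
    have h1 := hexp α (by rwa [abs_of_pos hα])
    have h2 := hexp (-α) (by rwa [abs_neg, abs_of_pos hα])
    set lp := ∑ i, q i * Real.exp (α * Real.log |a i|)
    set ln := ∑ i, q i * Real.exp (-α * Real.log |a i|)
    set lam := 1 + α * m + (K + 1) * α ^ 2 with hlam
    have hm0 : 0 ≤ m := abs_nonneg _
    have hlp : lp ≤ lam := by nlinarith [le_abs_self (∑ i, q i * Real.log |a i|)]
    have hln : ln ≤ lam - α ^ 2 := by nlinarith [neg_abs_le (∑ i, q i * Real.log |a i|)]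
    have hlam0 : 0 < lam := by positivity
    set b : Fin κ → ℝ := fun i => wd (toEuc (A i) v') v' / wd v v' with hb
    set β := ∑ i, q i * |b i| ^ α
    have hβ : 0 ≤ β := Finset.sum_nonneg fun i _ => mul_nonneg (hq i).le (by positivity)
    set R := β / α ^ 2 + 1 with hR
    have hR1 : 1 ≤ R := by
      have : 0 ≤ β / α ^ 2 := by positivity
      linarith
    have hY : ∀ i z, |wd v (toEuc (A i) z)| ^ α = Real.exp (-α * Real.log |a i|) * |wd v z| ^ α := by
      intro i z
      have h : a i * wd v (toEuc (A i) z) = wd v z := by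
        rw [← wd_smul_left, ← hav, wd_act]
      rw [← h, abs_mul, Real.mul_rpow (abs_nonneg _) (abs_nonneg _), rpow_exp (ha i), ← mul_assoc,
        ← Real.exp_add]
      simp
    have hX : ∀ i z, |wd (toEuc (A i) z) v'| ^ α ≤
        Real.exp (α * Real.log |a i|) * |wd z v'| ^ α + |b i| ^ α * |wd v z| ^ α := by
      intro i z
      have h : wd (toEuc (A i) z) v' = a i * wd z v' + b i * wd v z := by
        have h3 := congrArg (fun x => wd (toEuc (A i) x) v') (cramer v v' z)
        simp only [map_add, map_smul, wd_add_left, wd_smul_left, hav] at h3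
        rw [hb]
        field_simp
        linarith
      rw [h, ← rpow_exp (ha i), ← Real.mul_rpow (abs_nonneg _) (abs_nonneg _),
        ← Real.mul_rpow (abs_nonneg _) (abs_nonneg _), ← abs_mul, ← abs_mul]
      calc |a i * wd z v' + b i * wd v z| ^ α ≤ (|a i * wd z v'| + |b i * wd v z|) ^ α :=
            Real.rpow_le_rpow (abs_nonneg _) (abs_add_le _ _) hα.le
        _ ≤ _ := Real.rpow_add_le_add_rpow (abs_nonneg _) (abs_nonneg _) hα.le hα1
    have hfin := lyap_le_of_super hq hq1 A (s := fun z => |wd z v'| ^ α + R * |wd v z| ^ α)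
      (α := α) (lam := lam) (K := C) hα hα1 hlam0 (fun z => ?_) (fun z => ?_) hC
    · have hlog := Real.log_le_sub_one_of_pos hlam0
      calc lyapLC q A ≤ α⁻¹ * Real.log lam := hfin
        _ ≤ α⁻¹ * (lam - 1) := by gcongr
        _ = _ := by rw [hlam]; field_simp; ring
    · refine (hcoord z).trans ?_
      have : (0:ℝ) ≤ |wd v z| ^ α := by positivity
      gcongr
      nlinarith
    · have hx0 : (0:ℝ) ≤ |wd z v'| ^ α := by positivity
      have hy0 : (0:ℝ) ≤ |wd v z| ^ α := by positivity
      calc ∑ i, q i * (|wd (toEuc (A i) z) v'| ^ α + R * |wd v (toEuc (A i) z)| ^ α)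
          ≤ ∑ i, (q i * Real.exp (α * Real.log |a i|) * |wd z v'| ^ α
              + q i * |b i| ^ α * |wd v z| ^ α
              + R * (q i * Real.exp (-α * Real.log |a i|) * |wd v z| ^ α)) := by
            refine Finset.sum_le_sum fun i _ => ?_
            rw [hY]
            have := mul_le_mul_of_nonneg_left (hX i z) (hq i).le
            linarith
        _ = lp * |wd z v'| ^ α + β * |wd v z| ^ α + R * (ln * |wd v z| ^ α) := by
            rw [Finset.sum_add_distrib, Finset.sum_add_distrib, ← Finset.mul_sum,
              ← Finset.sum_mul, ← Finset.sum_mul, ← Finset.sum_mul]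
        _ ≤ lam * |wd z v'| ^ α + (β + R * ln) * |wd v z| ^ α := by
            have := mul_le_mul_of_nonneg_right hlp hx0
            linarith
        _ ≤ lam * |wd z v'| ^ α + (lam * R) * |wd v z| ^ α := by
            have h5 : β = (R - 1) * α ^ 2 := by rw [hR]; field_simp; ring
            have h6 : β + R * ln ≤ lam * R := by
              have := mul_le_mul_of_nonneg_left hln (by linarith : 0 ≤ R)
              nlinarith [sq_nonneg α]
            gcongr
        _ = _ := by ring
  refine le_of_forall_pos_le_add fun ε hε => ?_
  have h := main (min α₀ (ε / (K + 1))) (by positivity) (min_le_left _ _)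
  have h2 : (K + 1) * min α₀ (ε / (K + 1)) ≤ (K + 1) * (ε / (K + 1)) := by
    gcongr; exact min_le_right _ _
  have h3 : (K + 1) * (ε / (K + 1)) = ε := by field_simp
  linarith

omit hq in
lemma line_EW {v : E2} (hv : v ≠ 0) (a : Fin κ → ℝ) (ha : ∀ i, a i ≠ 0)
    (hav : ∀ i, toEuc (A i) v = a i • v) (n : ℕ) :
    EW q A n (fun B => Real.log (‖toEuc B v‖ / ‖v‖)) = n * ∑ i, q i * Real.log |a i| := by
  have hv' : ‖v‖ ≠ 0 := norm_ne_zero_iff.2 hv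
  induction n with
  | zero => simp [EW, toEuc_one, hv']
  | succ n ih =>
    rw [EW]
    have : ∀ i, EW q A n (fun B => Real.log (‖toEuc (B * A i) v‖ / ‖v‖)) =
        Real.log |a i| + n * ∑ i, q i * Real.log |a i| := by
      intro i
      rw [← ih]
      conv_rhs => rw [← EW_const q hq1 A n (Real.log |a i|), ← EW_add]
      congr 1
      ext B
      have hB : ‖toEuc B v‖ ≠ 0 := norm_ne_zero_iff.2 (act_ne_zero B hv)
      rw [toEuc_mul, hav, map_smul, norm_smul, mul_div_assoc, Real.norm_eq_abs,
        Real.log_mul (abs_ne_zero.2 (ha i)) (div_ne_zero hB hv')]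
    simp only [this, mul_add, Finset.sum_add_distrib]
    rw [← Finset.sum_mul, hq1]; push_cast; ring

lemma line_case {v : E2} (hv : v ≠ 0) (a : Fin κ → ℝ) (ha : ∀ i, a i ≠ 0)
    (hav : ∀ i, toEuc (A i) v = a i • v) :
    lyapLC q A = |∑ i, q i * Real.log (|a i|)| := by
  have hv' : 0 < ‖v‖ := norm_pos_iff.2 hv
  refine le_antisymm (line_upper hq hq1 A hv a ha hav) ?_
  have h := line_EW hq1 A hv a ha hav
  rw [abs_le']
  constructor
  · refine le_lyap hq hq1 A (C := 0) fun n => ?_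
    rw [sub_zero, ← h]
    refine EW_mono q hq A n fun B => ?_
    have hB : 0 < ‖toEuc B v‖ := norm_pos_iff.2 (act_ne_zero B hv)
    refine Real.log_le_log (by positivity) ?_
    rw [div_le_iff₀ hv']; exact act_le B v
  · refine le_lyap hq hq1 A (C := 0) fun n => ?_
    rw [sub_zero, mul_neg, ← h, ← neg_one_mul, ← EW_mul]
    refine EW_mono q hq A n fun B => ?_
    have hB : 0 < ‖toEuc B v‖ := norm_pos_iff.2 (act_ne_zero B hv)
    rw [neg_one_mul, ← Real.log_inv, inv_div]
    refine Real.log_le_log (by positivity) ?_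
    rw [div_le_iff₀ hB]; exact le_act B v

lemma swap_case {v v' : E2} (hD : wd v v' ≠ 0)
    (h : ∀ i, (wd (toEuc (A i) v) v = 0 ∧ wd (toEuc (A i) v') v' = 0) ∨
      (wd (toEuc (A i) v) v' = 0 ∧ wd (toEuc (A i) v') v = 0))
    (i₀ : Fin κ) (hi₀ : ¬ (wd (toEuc (A i₀) v) v = 0 ∧ wd (toEuc (A i₀) v') v' = 0)) :
    lyapLC q A ≤ 0 := by
  classical
  have hv : v ≠ 0 := by rintro rfl; simp [wd] at hD
  have hv' : v' ≠ 0 := by rintro rfl; simp [wd] at hD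
  set P : Fin κ → Prop := fun i => wd (toEuc (A i) v) v = 0 ∧ wd (toEuc (A i) v') v' = 0 with hP
  -- logarithmic coefficients
  have hex : ∀ i, ∃ c : ℝ, c ≠ 0 ∧
      (P i → ∀ z, |wd (toEuc (A i) z) v'| = |c| * |wd z v'| ∧
        |c| * |wd v (toEuc (A i) z)| = |wd v z|) ∧
      (¬ P i → ∀ z, |wd v (toEuc (A i) z)| = |c| * |wd z v'| ∧
        |c| * |wd (toEuc (A i) z) v'| = |wd v z|) := by
    intro i
    by_cases hi : P i
    · obtain ⟨c, hc⟩ := parallel_of_wd hv hi.1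
      obtain ⟨c', hc'⟩ := parallel_of_wd hv' hi.2
      have hcc : c * c' = 1 := by
        have := wd_act (A i) v v'
        rw [hc, hc', wd_smul_left, wd_smul_right, ← mul_assoc] at this
        exact mul_right_cancel₀ hD (by rw [this, one_mul])
      have hc0 : c ≠ 0 := by rintro rfl; simp at hcc
      refine ⟨c, hc0, fun _ z => ⟨?_, ?_⟩, fun hn => absurd hi hn⟩
      · rw [← abs_mul]
        congr 1
        have h1 := wd_act (A i) z v'
        rw [hc', wd_smul_right] at h1
        rw [← h1, ← mul_assoc, hcc, one_mul]
      · rw [← abs_mul, ← wd_smul_left, ← hc, wd_act]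
    · have hi' := (h i).resolve_left hi
      obtain ⟨c, hc⟩ := parallel_of_wd hv' hi'.1
      obtain ⟨c', hc'⟩ := parallel_of_wd hv hi'.2
      have hcc : c * c' = -1 := by
        have := wd_act (A i) v v'
        rw [hc, hc', wd_smul_left, wd_smul_right, ← mul_assoc, wd_swap v' v] at this
        refine mul_right_cancel₀ hD (by linarith)
      have hc0 : c ≠ 0 := by rintro rfl; simp at hcc
      refine ⟨c, hc0, fun hn => absurd hn hi, fun _ z => ⟨?_, ?_⟩⟩
      · rw [← abs_mul]
        have h1 := wd_act (A i) z v'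
        rw [hc', wd_smul_right] at h1
        rw [← h1, ← mul_assoc, hcc, wd_swap v]
        simp
      · rw [← abs_mul, ← wd_smul_right, ← hc, wd_act, wd_swap, abs_neg]
  choose c hc0 hcP hcN using hex
  set w := ∑ i, (if P i then 0 else q i) with hw
  have hwpos : 0 < w := by
    refine Finset.sum_pos' (fun i _ => ?_) ⟨i₀, Finset.mem_univ _, ?_⟩
    · split_ifs
      · exact le_rfl
      · exact (hq i).le
    · rw [if_neg hi₀]; exact hq i₀
  set b := (∑ i, q i * Real.log |c i|) / w with hb
  set l : Fin κ → ℝ := fun i => Real.log |c i| - (if P i then 0 else b) with hl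
  have hl0 : ∑ i, q i * l i = 0 := by
    have h1 : ∀ i, q i * l i = q i * Real.log |c i| - (if P i then 0 else q i) * b := by
      intro i
      simp only [hl]
      split_ifs <;> ring
    simp only [h1, Finset.sum_sub_distrib]
    rw [← Finset.sum_mul, ← hw, hb]
    field_simp; ring
  obtain ⟨K, α₀, hK, hα₀, hα₀1, hexp⟩ := exp_second_order q hq hq1 l
  have main : ∀ α, 0 < α → α ≤ α₀ → lyapLC q A ≤ K * α := by
    intro α hα hαα
    have hα1 : α ≤ 1 := hαα.trans hα₀1
    obtain ⟨C, hC, hcoord⟩ := norm_rpow_le_coord hD hα hα1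
    have h1 := hexp α (by rwa [abs_of_pos hα])
    have h2 := hexp (-α) (by rwa [abs_neg, abs_of_pos hα])
    rw [hl0, mul_zero, add_zero] at h1 h2
    rw [neg_sq] at h2
    set lam := 1 + K * α ^ 2 with hlam
    have hlam0 : 0 < lam := by positivity
    have hfin := lyap_le_of_super hq hq1 A
      (s := fun z => Real.exp (α * b) * |wd z v'| ^ α + |wd v z| ^ α)
      (α := α) (lam := lam) (K := C * (1 + Real.exp (-(α * b)))) hα hα1 hlam0 (fun z => ?_)
      (fun z => ?_) (by positivity)
    · have hlog := Real.log_le_sub_one_of_pos hlam0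
      calc lyapLC q A ≤ α⁻¹ * Real.log lam := hfin
        _ ≤ α⁻¹ * (lam - 1) := by gcongr
        _ = _ := by rw [hlam]; field_simp; ring
    · refine (hcoord z).trans ?_
      have hx : (0:ℝ) ≤ |wd z v'| ^ α := by positivity
      have hy : (0:ℝ) ≤ |wd v z| ^ α := by positivity
      rw [mul_assoc]
      gcongr
      have he : Real.exp (-(α * b)) * Real.exp (α * b) = 1 := by rw [← Real.exp_add]; simp
      have : (1 + Real.exp (-(α * b))) * (Real.exp (α * b) * |wd z v'| ^ α + |wd v z| ^ α)
        = (|wd z v'| ^ α + |wd v z| ^ α) + (Real.exp (α * b) * |wd z v'| ^ α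
          + Real.exp (-(α * b)) * |wd v z| ^ α) := by
        linear_combination (|wd z v'| ^ α) * he
      rw [this]
      have : 0 ≤ Real.exp (α * b) * |wd z v'| ^ α
          + Real.exp (-(α * b)) * |wd v z| ^ α := by positivity
      linarith
    · have hx0 : (0:ℝ) ≤ |wd z v'| ^ α := by positivity
      have hy0 : (0:ℝ) ≤ |wd v z| ^ α := by positivity
      have hterm : ∀ i, Real.exp (α * b) * |wd (toEuc (A i) z) v'| ^ α
          + |wd v (toEuc (A i) z)| ^ α = Real.exp (α * l i) * (Real.exp (α * b) * |wd z v'| ^ α)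
            + Real.exp (-α * l i) * |wd v z| ^ α := by
        intro i
        have hcp := abs_pos.2 (hc0 i)
        have div_form : ∀ x y : ℝ, |c i| * |x| = |y| →
            |x| ^ α = Real.exp (-α * Real.log |c i|) * |y| ^ α := by
          intro x y hxy
          rw [← hxy, Real.mul_rpow (abs_nonneg _) (abs_nonneg _), rpow_exp (hc0 i), ← mul_assoc,
            ← Real.exp_add]
          simp
        by_cases hi : P i
        · obtain ⟨e1, e2⟩ := hcP i hi z
          rw [e1, div_form _ _ e2, Real.mul_rpow (abs_nonneg _) (abs_nonneg _), rpow_exp (hc0 i)]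
          simp only [hl, if_pos hi, sub_zero]
          ring
        · obtain ⟨e1, e2⟩ := hcN i hi z
          rw [e1, div_form _ _ e2, Real.mul_rpow (abs_nonneg _) (abs_nonneg _), rpow_exp (hc0 i)]
          simp only [hl, if_neg hi]
          rw [← mul_assoc, ← mul_assoc, ← Real.exp_add, ← Real.exp_add, add_comm]
          congr 3 <;> ring
      calc ∑ i, q i * (Real.exp (α * b) * |wd (toEuc (A i) z) v'| ^ α
          + |wd v (toEuc (A i) z)| ^ α)
          = (∑ i, q i * Real.exp (α * l i)) * (Real.exp (α * b) * |wd z v'| ^ α)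
            + (∑ i, q i * Real.exp (-α * l i)) * |wd v z| ^ α := by
            rw [Finset.sum_mul, Finset.sum_mul, ← Finset.sum_add_distrib]
            refine Finset.sum_congr rfl fun i _ => ?_
            rw [hterm]; ring
        _ ≤ lam * (Real.exp (α * b) * |wd z v'| ^ α) + lam * |wd v z| ^ α := by
            gcongr
        _ = _ := by ring
  refine le_of_forall_pos_le_add fun ε hε => ?_
  have h := main (min α₀ (ε / (K + 1))) (by positivity) (min_le_left _ _)
  have h2 : (K + 1) * min α₀ (ε / (K + 1)) ≤ (K + 1) * (ε / (K + 1)) := by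
    gcongr; exact min_le_right _ _
  have h3 : (K + 1) * (ε / (K + 1)) = ε := by field_simp
  have h4 : 0 < min α₀ (ε / (K + 1)) := by positivity
  linarith
end
/-! ### The analytic core -/

lemma resolvent_analytic {κ : ℕ} {X : Type*} [NormedAddCommGroup X] [NormedSpace ℝ X]
    [CompleteSpace X] (T : (Fin κ → ℝ) →L[ℝ] (X →L[ℝ] X)) (Φ : (Fin κ → ℝ) →L[ℝ] X)
    (U : Set (Fin κ → ℝ)) (hU : ∀ q ∈ U, ‖T q‖ < 1) :
    ∃ G : (Fin κ → ℝ) → X, AnalyticOnNhd ℝ G U ∧ ∀ q ∈ U, G q = Φ q + T q (G q) := by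
  refine ⟨fun q => Ring.inverse (1 - T q) (Φ q), fun q hq => ?_, fun q hq => ?_⟩
  · have hu := isUnit_one_sub_of_norm_lt_one (hU q hq)
    have h1 : AnalyticAt ℝ (fun q => (1 : X →L[ℝ] X) - T q) q :=
      analyticAt_const.sub (T.analyticAt q)
    have h2 : AnalyticAt ℝ (Ring.inverse : (X →L[ℝ] X) → (X →L[ℝ] X)) (1 - T q) := by
      have := analyticAt_inverse (𝕜 := ℝ) hu.unit
      rwa [IsUnit.unit_spec] at this
    have h3 : AnalyticAt ℝ (fun q => Ring.inverse ((1 : X →L[ℝ] X) - T q)) q :=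
      AnalyticAt.fun_comp (g := Ring.inverse) h2 h1
    have h4 := (ContinuousLinearMap.analyticAt_bilinear
      (ContinuousLinearMap.id ℝ (X →L[ℝ] X))
        (Ring.inverse ((1 : X →L[ℝ] X) - T q), Φ q)).comp₂ (x := q) h3 (Φ.analyticAt q)
    exact h4
  · have hu := isUnit_one_sub_of_norm_lt_one (hU q hq)
    have h := Ring.mul_inverse_cancel _ hu
    have h2 := congrArg (fun S : X →L[ℝ] X => S (Φ q)) h
    simp only [ContinuousLinearMap.mul_apply, ContinuousLinearMap.sub_apply,
      ContinuousLinearMap.one_apply] at h2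
    exact sub_eq_iff_eq_add.1 h2

lemma exists_lincomb {κ : ℕ} {X : Type*} [NormedAddCommGroup X] [NormedSpace ℝ X] (T : Fin κ → X) :
    ∃ TT : (Fin κ → ℝ) →L[ℝ] X, ∀ q, TT q = ∑ i, q i • T i := by
  refine ⟨∑ i, (ContinuousLinearMap.proj (R := ℝ) (φ := fun _ : Fin κ => ℝ) i).smulRight (T i), ?_⟩
  intro q
  simp [ContinuousLinearMap.sum_apply]

open BoundedContinuousFunction in
lemma exists_weighted {D : Type*} [TopologicalSpace D] [DiscreteTopology D] (r : D → ℝ) (K : ℝ)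
    (hr : ∀ z, |r z| ≤ K) (hK : 0 ≤ K) (a : D → D) :
    ∃ T : (D →ᵇ ℝ) →L[ℝ] (D →ᵇ ℝ), ∀ F z, T F z = r z * F (a z) := by
  have hb : ∀ (F : D →ᵇ ℝ) z, ‖r z * F (a z)‖ ≤ K * ‖F‖ := by
    intro F z
    rw [norm_mul]
    exact mul_le_mul (hr z) (F.norm_coe_le_norm _) (norm_nonneg _) hK
  let T0 : (D →ᵇ ℝ) →ₗ[ℝ] (D →ᵇ ℝ) :=
    { toFun := fun F => ofNormedAddCommGroupDiscrete (fun z => r z * F (a z)) (K * ‖F‖) (hb F)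
      map_add' := fun F G => by ext z; simp [mul_add]
      map_smul' := fun c F => by ext z; simp; ring }
  refine ⟨T0.mkContinuous K fun F => ?_, fun F z => rfl⟩
  exact (BoundedContinuousFunction.norm_le (by positivity)).2 fun z => hb F z

/-- Birkhoff sums of expected increments. -/
def fS {κ : ℕ} {S : Type*} (a : Fin κ → S → S) (φ : Fin κ → S → ℝ) (q : Fin κ → ℝ) : ℕ → S → ℝ
  | 0, _ => 0
  | n + 1, x => ∑ i, q i * (φ i x + fS a φ q n (a i x))

open BoundedContinuousFunction in
lemma analytic_core {κ : ℕ} {S : Type*} (a : Fin κ → S → S) (φ : Fin κ → S → ℝ)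
    (W : S × S → ℝ) (p : Fin κ → ℝ) (hp : ∀ i, 0 < p i) {ρ K C : ℝ} (hρ0 : 0 < ρ) (hρ : ρ < 1)
    (hW0 : ∀ z, 0 ≤ W z) (hWK : ∀ z, W z ≤ K)
    (hW : ∀ x y, ∑ i, p i * W (a i x, a i y) ≤ ρ * W (x, y))
    (hC : 0 ≤ C)
    (hφ : ∀ i x y, |φ i x - φ i y| ≤ C * W (x, y)) (x₀ : S) :
    ∃ U : Set (Fin κ → ℝ), IsOpen U ∧ p ∈ U ∧ ∃ F : (Fin κ → ℝ) → ℝ, AnalyticOnNhd ℝ F U ∧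
      ∀ q ∈ U, (∀ i, 0 < q i) → ∑ i, q i = 1 → ∃ C' : ℝ, ∀ n x, |fS a φ q n x - n * F q| ≤ C' := by
  letI : TopologicalSpace (S × S) := ⊥
  haveI : DiscreteTopology (S × S) := ⟨rfl⟩
  set a2 : Fin κ → S × S → S × S := fun i z => (a i z.1, a i z.2) with ha2
  have hW' : ∀ z, ∑ i, p i * W (a2 i z) ≤ ρ * W z := fun z => hW z.1 z.2
  have hWi : ∀ i z, p i * W (a2 i z) ≤ ρ * W z := by
    intro i z
    refine le_trans ?_ (hW' z)
    exact Finset.single_le_sum (f := fun i => p i * W (a2 i z))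
      (fun i _ => mul_nonneg (hp i).le (hW0 _)) (Finset.mem_univ i)
  have hr : ∀ i z, |W (a2 i z) / W z| ≤ ρ / p i := by
    intro i z
    rw [abs_of_nonneg (div_nonneg (hW0 _) (hW0 _))]
    rcases (hW0 z).eq_or_lt with h | h
    · rw [← h, div_zero]; have := hp i; positivity
    · rw [div_le_div_iff₀ h (hp i)]; linarith [hWi i z]
  have hrW : ∀ i z, W z * (W (a2 i z) / W z) = W (a2 i z) := by
    intro i z
    rcases (hW0 z).eq_or_lt with h | h
    · have h1 := hWi i z
      rw [← h, mul_zero] at h1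
      have h2 : W (a2 i z) = 0 := by
        have := hp i
        have := hW0 (a2 i z)
        nlinarith
      rw [h2]; simp
    · field_simp
  choose T hT using fun i => exists_weighted (fun z => W (a2 i z) / W z) (ρ / p i) (hr i)
    (div_nonneg hρ0.le (hp i).le) (a2 i)
  have hΦb : ∀ i (z : S × S), ‖(φ i z.1 - φ i z.2) / W z‖ ≤ C := by
    intro i z
    rw [Real.norm_eq_abs, abs_div, abs_of_nonneg (hW0 z)]
    rcases (hW0 z).eq_or_lt with h | h
    · rw [← h, div_zero]; exact hC
    · rw [div_le_iff₀ h]; exact hφ i z.1 z.2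
  let Φ : Fin κ → ((S × S) →ᵇ ℝ) := fun i =>
    ofNormedAddCommGroupDiscrete (fun z => (φ i z.1 - φ i z.2) / W z) C (hΦb i)
  have hΦ : ∀ i z, W z * Φ i z = φ i z.1 - φ i z.2 := by
    intro i z
    change W z * ((φ i z.1 - φ i z.2) / W z) = _
    rcases (hW0 z).eq_or_lt with h | h
    · have h1 := hφ i z.1 z.2
      rw [Prod.mk.eta, ← h, mul_zero] at h1
      rw [abs_nonpos_iff.1 h1]; simp
    · field_simp
  obtain ⟨TT, hTT0⟩ := exists_lincomb T
  obtain ⟨PP, hPP0⟩ := exists_lincomb Φ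
  have hTT : ∀ q F z, TT q F z = ∑ i, q i * (W (a2 i z) / W z * F (a2 i z)) := by
    intro q F z
    rw [hTT0]
    simp [ContinuousLinearMap.sum_apply, BoundedContinuousFunction.sum_apply, hT]
  have hPP : ∀ q z, PP q z = ∑ i, q i * Φ i z := by
    intro q z
    rw [hPP0]
    simp [BoundedContinuousFunction.sum_apply]
  set t : ℝ := 2 / (1 + ρ) with ht
  have ht1 : 1 < t := by rw [ht, lt_div_iff₀ (by linarith)]; linarith
  set θ : ℝ := t * ρ with hθ
  have hθ0 : 0 < θ := by positivity
  have hθ1 : θ < 1 := by rw [hθ, ht, div_mul_eq_mul_div, div_lt_iff₀ (by linarith)]; linarith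
  let U : Set (Fin κ → ℝ) := {q | ∀ i, |q i| < t * p i}
  have hUo : IsOpen U := by
    have : U = ⋂ i, {q : Fin κ → ℝ | |q i| < t * p i} := by ext q; simp [U]
    rw [this]
    exact isOpen_iInter_of_finite fun i => isOpen_lt (by fun_prop) continuous_const
  have hpU : p ∈ U := fun i => by
    rw [abs_of_pos (hp i)]; nlinarith [hp i]
  have hUW : ∀ q ∈ U, ∀ z, ∑ i, |q i| * W (a2 i z) ≤ θ * W z := by
    intro q hq z
    calc ∑ i, |q i| * W (a2 i z) ≤ ∑ i, t * (p i * W (a2 i z)) := by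
          refine Finset.sum_le_sum fun i _ => ?_
          rw [← mul_assoc]
          exact mul_le_mul_of_nonneg_right (hq i).le (hW0 _)
      _ ≤ t * (ρ * W z) := by
          rw [← Finset.mul_sum]
          exact mul_le_mul_of_nonneg_left (hW' z) (by linarith)
      _ = _ := by rw [hθ]; ring
  have hTn : ∀ q ∈ U, ‖TT q‖ < 1 := by
    intro q hq
    refine lt_of_le_of_lt (ContinuousLinearMap.opNorm_le_bound _ hθ0.le fun F => ?_) hθ1
    refine (BoundedContinuousFunction.norm_le (by positivity)).2 fun z => ?_
    rw [hTT]
    calc ‖∑ i, q i * (W (a2 i z) / W z * F (a2 i z))‖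
        ≤ ∑ i, |q i| * (W (a2 i z) / W z) * ‖F‖ := by
          refine (norm_sum_le _ _).trans (Finset.sum_le_sum fun i _ => ?_)
          rw [norm_mul, norm_mul, Real.norm_eq_abs, Real.norm_eq_abs,
            abs_of_nonneg (div_nonneg (hW0 (a2 i z)) (hW0 z)), mul_assoc]
          have := div_nonneg (hW0 (a2 i z)) (hW0 z)
          gcongr
          exact F.norm_coe_le_norm _
      _ = (∑ i, |q i| * W (a2 i z)) / W z * ‖F‖ := by
          rw [← Finset.sum_mul, Finset.sum_div]
          simp only [mul_div_assoc]
      _ ≤ θ * ‖F‖ := by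
          gcongr
          rcases (hW0 z).eq_or_lt with h | h
          · rw [← h, div_zero]; exact hθ0.le
          · rw [div_le_iff₀ h]; exact hUW q hq z
  obtain ⟨G, hGa, hG⟩ := resolvent_analytic TT PP U hTn
  refine ⟨U, hUo, hpU, fun q => ∑ i, q i * (φ i x₀ + W (a i x₀, x₀) * G q (a i x₀, x₀)), ?_, ?_⟩
  · intro q hq
    refine Finset.analyticAt_fun_sum _ fun i _ => ?_
    have hev : AnalyticAt ℝ (fun q => G q (a i x₀, x₀)) q :=
      AnalyticAt.fun_comp (f := G) (x := q)
        (((BoundedContinuousFunction.evalCLM (β := ℝ) ℝ (a i x₀, x₀))).analyticAt (G q)) (hGa q hq)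
    exact ((ContinuousLinearMap.proj (R := ℝ) (φ := fun _ : Fin κ => ℝ) i).analyticAt q).mul
      (analyticAt_const.add (analyticAt_const.mul hev))
  · intro q hq hqp hq1
    set g := G q with hg
    set γ : S × S → ℝ := fun z => W z * g z with hγ
    have hγeq : ∀ z, γ z = ∑ i, q i * (φ i z.1 - φ i z.2 + γ (a2 i z)) := by
      intro z
      have h1 : g z = PP q z + TT q g z := by
        conv_lhs => rw [hg, hG q hq]
        rfl
      simp only [hγ]
      rw [h1, hPP, hTT, mul_add, Finset.mul_sum, Finset.mul_sum, ← Finset.sum_add_distrib]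
      refine Finset.sum_congr rfl fun i _ => ?_
      have e1 := hΦ i z
      have e2 := hrW i z
      linear_combination q i * e1 + q i * g (a2 i z) * e2
    have hγb : ∀ z, |γ z| ≤ ‖g‖ * W z := by
      intro z
      simp only [hγ]
      rw [abs_mul, abs_of_nonneg (hW0 z), mul_comm]
      exact mul_le_mul_of_nonneg_right (g.norm_coe_le_norm z) (hW0 z)
    have he : ∀ n z, |γ z - (fS a φ q n z.1 - fS a φ q n z.2)| ≤ θ ^ n * (‖g‖ * W z) := by
      intro n
      induction n with
      | zero => intro z; simpa [fS] using hγb z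
      | succ n ih =>
        intro z
        have h1 : γ z - (fS a φ q (n+1) z.1 - fS a φ q (n+1) z.2) =
          ∑ i, q i * (γ (a2 i z) - (fS a φ q n (a2 i z).1 - fS a φ q n (a2 i z).2)) := by
          rw [hγeq]
          simp only [fS]
          rw [← Finset.sum_sub_distrib, ← Finset.sum_sub_distrib]
          refine Finset.sum_congr rfl fun i _ => ?_
          simp only [ha2]
          ring
        rw [h1]
        calc |∑ i, q i * (γ (a2 i z) - (fS a φ q n (a2 i z).1 - fS a φ q n (a2 i z).2))|
            ≤ ∑ i, |q i| * (θ ^ n * (‖g‖ * W (a2 i z))) := by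
              refine (Finset.abs_sum_le_sum_abs _ _).trans (Finset.sum_le_sum fun i _ => ?_)
              rw [abs_mul]
              exact mul_le_mul_of_nonneg_left (ih _) (abs_nonneg _)
          _ = θ ^ n * ‖g‖ * ∑ i, |q i| * W (a2 i z) := by
              rw [Finset.mul_sum]
              exact Finset.sum_congr rfl fun i _ => by ring
          _ ≤ θ ^ n * ‖g‖ * (θ * W z) := by
              gcongr
              exact hUW q hq z
          _ = _ := by ring
    have hK0 : 0 ≤ K := (hW0 (x₀, x₀)).trans (hWK _)
    set F := ∑ i, q i * (φ i x₀ + W (a i x₀, x₀) * g (a i x₀, x₀)) with hF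
    set M := ‖g‖ * K with hM
    have hM0 : 0 ≤ M := by positivity
    have hstep : ∀ n, |fS a φ q (n+1) x₀ - fS a φ q n x₀ - F| ≤ θ ^ n * M := by
      intro n
      have h1 : fS a φ q (n+1) x₀ - fS a φ q n x₀ - F =
          - ∑ i, q i * (γ (a i x₀, x₀) - (fS a φ q n (a i x₀) - fS a φ q n x₀)) := by
        have : fS a φ q n x₀ = ∑ i, q i * fS a φ q n x₀ := by rw [← Finset.sum_mul, hq1, one_mul]
        rw [hF, fS]
        conv_lhs => rw [this]
        rw [← Finset.sum_sub_distrib, ← Finset.sum_sub_distrib, ← Finset.sum_neg_distrib]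
        refine Finset.sum_congr rfl fun i _ => ?_
        simp only [hγ]
        ring
      rw [h1, abs_neg]
      calc _ ≤ ∑ i, q i * (θ ^ n * M) := by
            refine (Finset.abs_sum_le_sum_abs _ _).trans (Finset.sum_le_sum fun i _ => ?_)
            rw [abs_mul, abs_of_pos (hqp i)]
            refine mul_le_mul_of_nonneg_left ((he n (a i x₀, x₀)).trans ?_) (hqp i).le
            rw [hM]
            gcongr
            exact hWK _
        _ = _ := by rw [← Finset.sum_mul, hq1, one_mul]
    have hsum : ∀ n : ℕ, |fS a φ q n x₀ - n * F| ≤ M * ((1 - θ ^ n) / (1 - θ)) := by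
      intro n
      induction n with
      | zero => simp [fS]
      | succ n ih =>
        have h1 := hstep n
        have h2 : fS a φ q (n+1) x₀ - (n+1 : ℕ) * F = (fS a φ q n x₀ - n * F) +
          (fS a φ q (n+1) x₀ - fS a φ q n x₀ - F) := by push_cast; ring
        rw [h2]
        refine (abs_add_le _ _).trans ((add_le_add ih h1).trans (le_of_eq ?_))
        have : 1 - θ ≠ 0 := by linarith
        field_simp
        ring
    refine ⟨M / (1 - θ) + 2 * M, fun n x => ?_⟩
    have h1 : |fS a φ q n x₀ - n * F| ≤ M / (1 - θ) := by
      refine (hsum n).trans ?_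
      rw [mul_div_assoc']
      have : 0 < 1 - θ := by linarith
      gcongr
      have : 0 < θ ^ n := by positivity
      nlinarith
    have h2 := he n (x, x₀)
    have h3 := hγb (x, x₀)
    have h4 : ‖g‖ * W (x, x₀) ≤ M := by rw [hM]; gcongr; exact hWK _
    have h5 : θ ^ n * (‖g‖ * W (x, x₀)) ≤ M := by
      have : θ ^ n ≤ 1 := pow_le_one₀ hθ0.le hθ1.le
      have : 0 < θ ^ n := by positivity
      have : 0 ≤ ‖g‖ * W (x, x₀) := mul_nonneg (norm_nonneg _) (hW0 _)
      nlinarith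
    simp only at h2 h3
    rw [abs_le] at *
    constructor <;> linarith [h1.1, h1.2, h2.1, h2.2, h3.1, h3.2]
/-! ### Projective distance and log-increments -/

def lr (g : SL2) (x : E2) : ℝ := Real.log (‖toEuc g x‖ / ‖x‖)

def dd (x y : E2) : ℝ := |wd x y| / (‖x‖ * ‖y‖)

lemma act_pos (g : SL2) {x : E2} (hx : x ≠ 0) : 0 < ‖toEuc g x‖ :=
  norm_pos_iff.2 (act_ne_zero g hx)

lemma exp_lr (g : SL2) {x : E2} (hx : x ≠ 0) : Real.exp (lr g x) = ‖toEuc g x‖ / ‖x‖ :=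
  Real.exp_log (div_pos (act_pos g hx) (norm_pos_iff.2 hx))

lemma lr_le (g : SL2) {x : E2} (hx : x ≠ 0) : lr g x ≤ Real.log ‖toEuc g‖ := by
  have h0 := norm_pos_iff.2 hx
  refine Real.log_le_log (div_pos (act_pos g hx) h0) ?_
  rw [div_le_iff₀ h0]; exact act_le g x

lemma le_lr (g : SL2) {x : E2} (hx : x ≠ 0) : - Real.log ‖toEuc g‖ ≤ lr g x := by
  have h0 := norm_pos_iff.2 hx
  have h1 := one_le_norm g
  rw [← Real.log_inv]
  refine Real.log_le_log (by positivity) ?_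
  rw [le_div_iff₀ h0, inv_mul_le_iff₀ (by linarith)]
  exact le_act g x

lemma lr_mul (g h : SL2) {x : E2} (hx : x ≠ 0) : lr (g * h) x = lr g (toEuc h x) + lr h x := by
  have h0 := norm_pos_iff.2 hx
  have h1 := act_pos h hx
  have h2 := act_pos g (act_ne_zero h hx)
  unfold lr
  rw [← Real.log_mul (by positivity) (by positivity), toEuc_mul]
  congr 1
  field_simp

lemma lr_one (x : E2) : lr 1 x = 0 := by
  unfold lr
  rw [toEuc_one]
  by_cases h : ‖x‖ = 0
  · simp [h]
  · rw [div_self h, Real.log_one]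

lemma dd_nonneg (x y : E2) : 0 ≤ dd x y := by unfold dd; positivity

lemma dd_le_one (x y : E2) : dd x y ≤ 1 :=
  div_le_one_of_le₀ (wd_le x y) (by positivity)

lemma dd_act (g : SL2) {x y : E2} (hx : x ≠ 0) (hy : y ≠ 0) :
    dd (toEuc g x) (toEuc g y) = dd x y * (Real.exp (- lr g x) * Real.exp (- lr g y)) := by
  rw [Real.exp_neg, Real.exp_neg, exp_lr g hx, exp_lr g hy, dd, dd, wd_act]
  have h0 := norm_pos_iff.2 hx
  have h1 := norm_pos_iff.2 hy
  have h2 := act_pos g hx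
  have h3 := act_pos g hy
  field_simp

lemma dd_comm (x y : E2) : dd x y = dd y x := by
  unfold dd
  have : wd x y = - wd y x := by unfold wd; ring
  rw [this, abs_neg, mul_comm]

/-- inner product -/
def ip (x y : E2) : ℝ := x 0 * y 0 + x 1 * y 1

lemma ip_le (x y : E2) : |ip x y| ≤ ‖x‖ * ‖y‖ := by
  apply abs_le_of_sq_le_sq _ (by positivity)
  rw [mul_pow, nsq, nsq, ip]
  nlinarith [sq_nonneg (x 0 * y 1 - x 1 * y 0)]

lemma decomp (x y : E2) : (‖y‖ ^ 2) • x = ip x y • y + wd y x • rot y := by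
  rw [nsq]
  ext i
  fin_cases i <;> simp [ip, wd, rot] <;> ring

lemma dd_tri (x y z : E2) (hx : x ≠ 0) (hy : y ≠ 0) (hz : z ≠ 0) :
    dd x z ≤ dd x y + dd y z := by
  have h0 := norm_pos_iff.2 hx
  have h1 := norm_pos_iff.2 hy
  have h2 := norm_pos_iff.2 hz
  have h3 : wd x z * ‖y‖ ^ 2 = ip x y * wd y z + wd x y * ip y z := by
    rw [nsq, ip, ip, wd, wd, wd]; ring
  have h4 : |wd x z| * ‖y‖ ^ 2 ≤ (‖x‖ * ‖y‖) * |wd y z| + |wd x y| * (‖y‖ * ‖z‖) := by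
    rw [← abs_of_nonneg (sq_nonneg ‖y‖), ← abs_mul, h3]
    refine (abs_add_le _ _).trans ?_
    rw [abs_mul, abs_mul]
    gcongr
    · exact ip_le x y
    · exact ip_le y z
  unfold dd
  have e : |wd x y| / (‖x‖ * ‖y‖) + |wd y z| / (‖y‖ * ‖z‖) =
    ((‖x‖ * ‖y‖) * |wd y z| + |wd x y| * (‖y‖ * ‖z‖)) / (‖x‖ * ‖y‖^2 * ‖z‖) := by
    field_simp; ring
  rw [e, div_le_div_iff₀ (by positivity) (by positivity)]
  have := mul_le_mul_of_nonneg_right h4 (by positivity : 0 ≤ ‖x‖ * ‖z‖)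
  linarith

lemma lr_lip1 (g : SL2) {x y : E2} (hx : x ≠ 0) (hy : y ≠ 0) :
    lr g x - lr g y ≤ ‖toEuc g‖ ^ 2 * dd x y := by
  have h0 := norm_pos_iff.2 hx
  have h1 := norm_pos_iff.2 hy
  have h2 := act_pos g hx
  have h3 := act_pos g hy
  have hg := one_le_norm g
  have h4 : ‖y‖ ^ 2 * ‖toEuc g x‖ ≤ (‖x‖ * ‖y‖) * ‖toEuc g y‖ + |wd x y| * (‖toEuc g‖ * ‖y‖) := by
    have h5 := congrArg (toEuc g) (decomp x y)
    rw [map_smul, map_add, map_smul, map_smul] at h5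
    have h6 := congrArg norm h5
    rw [norm_smul, Real.norm_eq_abs, abs_of_nonneg (sq_nonneg ‖y‖)] at h6
    rw [h6]
    refine (norm_add_le _ _).trans ?_
    rw [norm_smul, norm_smul, Real.norm_eq_abs, Real.norm_eq_abs]
    have h7 : |wd y x| = |wd x y| := by rw [← abs_neg]; congr 1; unfold wd; ring
    rw [h7]
    gcongr
    · exact ip_le x y
    · rw [← rot_norm y]; exact act_le g _
  have h5 : lr g x - lr g y = Real.log ((‖toEuc g x‖ / ‖x‖) / (‖toEuc g y‖ / ‖y‖)) := by
    unfold lr; rw [Real.log_div (x := _ / _) (by positivity) (by positivity)]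
  rw [h5]
  refine (Real.log_le_sub_one_of_pos (by positivity)).trans ?_
  have h8 := le_act g y
  rw [tsub_le_iff_right]
  have h9 : (‖toEuc g x‖ / ‖x‖) / (‖toEuc g y‖ / ‖y‖) ≤
      1 + |wd x y| * ‖toEuc g‖ / (‖x‖ * ‖toEuc g y‖) := by
    have e : 1 + |wd x y| * ‖toEuc g‖ / (‖x‖ * ‖toEuc g y‖) =
      ((‖x‖ * ‖y‖) * ‖toEuc g y‖ + |wd x y| * (‖toEuc g‖ * ‖y‖)) / (‖x‖ * ‖y‖ * ‖toEuc g y‖) := by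
      field_simp
    have e2 : (‖toEuc g x‖ / ‖x‖) / (‖toEuc g y‖ / ‖y‖) =
       (‖y‖ ^ 2 * ‖toEuc g x‖) / (‖x‖ * ‖y‖ * ‖toEuc g y‖) := by
      field_simp
    rw [e, e2]
    gcongr
  have h10 : |wd x y| * ‖toEuc g‖ / (‖x‖ * ‖toEuc g y‖) ≤ ‖toEuc g‖ ^ 2 * dd x y := by
    unfold dd
    rw [mul_div_assoc', div_le_div_iff₀ (by positivity) (by positivity)]
    have := mul_le_mul_of_nonneg_left h8 (by positivity : 0 ≤ |wd x y| * ‖toEuc g‖ * ‖x‖)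
    linarith
  linarith

lemma lr_lip (g : SL2) {x y : E2} (hx : x ≠ 0) (hy : y ≠ 0) :
    |lr g x - lr g y| ≤ ‖toEuc g‖ ^ 2 * dd x y := by
  have h1 := lr_lip1 g hx hy
  have h2 := lr_lip1 g hy hx
  rw [dd_comm] at h2
  rw [abs_le]; constructor <;> linarith

abbrev S2 : Type := {x : E2 // x ≠ 0}

def actS (g : SL2) (x : S2) : S2 := ⟨toEuc g x.1, act_ne_zero g x.2⟩

lemma fS_eq {κ : ℕ} (A : Fin κ → SL2) (q : Fin κ → ℝ) (hq1 : ∑ i, q i = 1) (n : ℕ) (x : S2) :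
    fS (fun i => actS (A i)) (fun i x => lr (A i) x.1) q n x = EW q A n (fun B => lr B x.1) := by
  induction n generalizing x with
  | zero => simp [fS, EW, lr_one]
  | succ n ih =>
    rw [fS, EW]
    refine Finset.sum_congr rfl fun i _ => ?_
    congr 1
    rw [ih]
    have : (fun B => lr (B * A i) x.1) = fun B => lr B (actS (A i) x).1 + lr (A i) x.1 := by
      funext B; exact lr_mul B (A i) x.2
    rw [this, EW_add, EW_const q hq1, add_comm]

def StarC {κ : ℕ} (q : Fin κ → ℝ) (A : Fin κ → SL2) : Prop :=
  ∃ N : ℕ, ∃ c : ℝ, 0 < c ∧ ∀ x : E2, x ≠ 0 → c ≤ EW q A N (fun B => lr B x)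

lemma exp_quad (t : ℝ) : Real.exp t ≤ 1 + t + t ^ 2 * Real.exp |t| := by
  rcases le_or_gt |t| 1 with h | h
  · have h1 := Real.abs_exp_sub_one_sub_id_le h
    have h2 : (1 : ℝ) ≤ Real.exp |t| := Real.one_le_exp (abs_nonneg t)
    have h3 := (abs_le.1 h1).2
    nlinarith [sq_nonneg t]
  · have h2 : (1 : ℝ) ≤ Real.exp |t| := Real.one_le_exp (abs_nonneg t)
    have h4 : |t| ≤ t ^ 2 := by rw [← sq_abs]; nlinarith
    rcases le_or_gt 0 t with h0 | h0
    · rw [abs_of_nonneg h0] at *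
      nlinarith
    · rw [abs_of_neg h0] at *
      have : Real.exp t ≤ 1 := Real.exp_le_one_iff.2 h0.le
      nlinarith

section contraction
variable {κ : ℕ} {q : Fin κ → ℝ} (hq : ∀ i, 0 < q i) (hq1 : ∑ i, q i = 1) (A : Fin κ → SL2)
include hq hq1

lemma star_pos_N {N : ℕ} {c : ℝ} (hc : 0 < c)
    (h : ∀ x : E2, x ≠ 0 → c ≤ EW q A N (fun B => lr B x)) : 0 < N := by
  rcases Nat.eq_zero_or_pos N with h0 | h0
  · subst h0
    have he : e1 ≠ 0 := by
      intro h; have := congrArg (fun v : E2 => v 0) h; simp [e1] at this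
    have := h e1 he
    simp [EW, lr_one] at this
    linarith
  · exact h0

lemma star_contr {N : ℕ} {c : ℝ} (hc : 0 < c)
    (h : ∀ x : E2, x ≠ 0 → c ≤ EW q A N (fun B => lr B x)) :
    ∃ α r : ℝ, 0 < α ∧ α ≤ 1 ∧ 0 < r ∧ r < 1 ∧ ∀ x y : E2, x ≠ 0 → y ≠ 0 →
      EW q A N (fun B => dd (toEuc B x) (toEuc B y) ^ α) ≤ r * dd x y ^ α := by
  set K := EW q A N (fun B => Real.log ‖toEuc B‖ ^ 2 * Real.exp (Real.log ‖toEuc B‖)) with hK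
  have hK0 : 0 ≤ K := by
    rw [← EW_const q hq1 A N 0]
    exact EW_mono q hq A N fun B => by positivity
  obtain ⟨α, hα0, hα1, hα2, hα3⟩ : ∃ α : ℝ, 0 < α ∧ 2 * α ≤ 1 ∧ α * c ≤ 1 / 2 ∧ 4 * α * K ≤ c := by
    refine ⟨min (1/2) (min (1 / (2 * c)) (c / (4 * (K + 1)))), by positivity, ?_, ?_, ?_⟩
    · have := min_le_left (1/2) (min (1 / (2 * c)) (c / (4 * (K + 1))))
      linarith
    · have h1 : min (1/2) (min (1 / (2 * c)) (c / (4 * (K + 1)))) ≤ 1 / (2 * c) :=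
        (min_le_right _ _).trans (min_le_left _ _)
      calc _ ≤ 1 / (2 * c) * c := by gcongr
        _ = _ := by field_simp
    · have h1 : min (1/2) (min (1 / (2 * c)) (c / (4 * (K + 1)))) ≤ c / (4 * (K + 1)) :=
        (min_le_right _ _).trans (min_le_right _ _)
      calc _ ≤ 4 * (c / (4 * (K + 1))) * K := by gcongr
        _ = c * (K / (K + 1)) := by field_simp
        _ ≤ c * 1 := by
          gcongr; rw [div_le_one (by linarith)]; linarith
        _ = c := mul_one c
  have key : ∀ x : E2, x ≠ 0 → EW q A N (fun B => Real.exp (-(2 * α) * lr B x)) ≤ 1 - α * c := by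
    intro x hx
    have h1 : EW q A N (fun B => Real.exp (-(2 * α) * lr B x)) ≤
        EW q A N (fun B => (1 + (-(2 * α)) * lr B x) + 4 * α ^ 2 *
          (Real.log ‖toEuc B‖ ^ 2 * Real.exp (Real.log ‖toEuc B‖))) := by
      refine EW_mono q hq A N fun B => ?_
      refine (exp_quad _).trans ?_
      have hl : |lr B x| ≤ Real.log ‖toEuc B‖ := abs_le.2 ⟨le_lr B hx, lr_le B hx⟩
      have h2 : |-(2 * α) * lr B x| ≤ Real.log ‖toEuc B‖ := by
        rw [abs_mul, abs_neg, abs_of_pos (by linarith)]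
        nlinarith [abs_nonneg (lr B x)]
      have h3 : (-(2 * α) * lr B x) ^ 2 ≤ 4 * α ^ 2 * Real.log ‖toEuc B‖ ^ 2 := by
        have : lr B x ^ 2 ≤ Real.log ‖toEuc B‖ ^ 2 := by
          rw [← sq_abs]; gcongr
        nlinarith [sq_nonneg α]
      have h4 := Real.exp_le_exp.2 h2
      have := mul_le_mul h3 h4 (Real.exp_pos _).le (by positivity)
      linarith
    rw [EW_add, EW_add, EW_mul, EW_mul, EW_const q hq1] at h1
    have h2 := h x hx
    rw [← hK] at h1
    nlinarith
  refine ⟨α, 1 - α * c, hα0, by linarith, by linarith, by nlinarith, fun x y hx hy => ?_⟩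
  have h1 : EW q A N (fun B => dd (toEuc B x) (toEuc B y) ^ α) ≤
      EW q A N (fun B => dd x y ^ α * (1/2) * (Real.exp (-(2 * α) * lr B x) +
        Real.exp (-(2 * α) * lr B y))) := by
    refine EW_mono q hq A N fun B => ?_
    rw [dd_act B hx hy, Real.mul_rpow (dd_nonneg _ _) (by positivity), ← Real.exp_add,
      ← Real.exp_mul, mul_assoc]
    refine mul_le_mul_of_nonneg_left ?_ (Real.rpow_nonneg (dd_nonneg _ _) _)
    have e1 : (-lr B x + -lr B y) * α = (-α * lr B x) + (-α * lr B y) := by ring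
    have e2 : -(2 * α) * lr B x = -α * lr B x + -α * lr B x := by ring
    have e3 : -(2 * α) * lr B y = -α * lr B y + -α * lr B y := by ring
    rw [e1, e2, e3, Real.exp_add, Real.exp_add, Real.exp_add]
    nlinarith [sq_nonneg (Real.exp (-α * lr B x) - Real.exp (-α * lr B y))]
  rw [EW_mul, EW_add] at h1
  have h2 := key x hx
  have h3 := key y hy
  have h4 : 0 ≤ dd x y ^ α := Real.rpow_nonneg (dd_nonneg _ _) _
  nlinarith

lemma star_analytic (hS : StarC q A) :
    ∃ U : Set (Fin κ → ℝ), IsOpen U ∧ q ∈ U ∧ ∃ F : (Fin κ → ℝ) → ℝ, AnalyticOnNhd ℝ F U ∧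
      ∀ q ∈ U, (∀ i, 0 < q i) → ∑ i, q i = 1 → ∃ C' : ℝ, ∀ (n : ℕ) (x : E2), x ≠ 0 →
        |EW q A n (fun B => lr B x) - n * F q| ≤ C' := by
  obtain ⟨N, c, hc, h⟩ := hS
  have hN := star_pos_N hq hq1 A hc h
  obtain ⟨α, r, hα0, hα1, hr0, hr1, hr⟩ := star_contr hq hq1 A hc h
  have hN1 : (1 : ℝ) ≤ N := by exact_mod_cast hN
  set ρ : ℝ := 1 - (1 - r) / N with hρ
  have hd : (1 - r) / N ≤ 1 - r := div_le_self (by linarith) hN1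
  have hd0 : 0 < (1 - r) / N := div_pos (by linarith) (by linarith)
  have hρ0 : 0 < ρ := by linarith
  have hρ1 : ρ < 1 := by linarith
  have hρN : r ≤ ρ ^ N := by
    have := one_add_mul_le_pow (a := -((1 - r) / N)) (by linarith) N
    have e : 1 + (N : ℝ) * -((1 - r) / N) = r := by field_simp; ring
    rw [e] at this
    rw [hρ, sub_eq_add_neg]; exact this
  let ψ : ℕ → E2 → E2 → ℝ := fun k x y => EW q A k (fun B => dd (toEuc B x) (toEuc B y) ^ α)
  have hψ0 : ∀ k x y, 0 ≤ ψ k x y := by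
    intro k x y
    rw [← EW_const q hq1 A k 0]
    exact EW_mono q hq A k fun B => Real.rpow_nonneg (dd_nonneg _ _) _
  have hψ1 : ∀ k x y, ψ k x y ≤ 1 := by
    intro k x y
    rw [← EW_const q hq1 A k 1]
    exact EW_mono q hq A k fun B => Real.rpow_le_one (dd_nonneg _ _) (dd_le_one _ _) hα0.le
  have hψz : ∀ x y, ψ 0 x y = dd x y ^ α := by
    intro x y; simp only [ψ, EW, toEuc_one]
  have hψs : ∀ k x y, ∑ i, q i * ψ k (toEuc (A i) x) (toEuc (A i) y) = ψ (k+1) x y := by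
    intro k x y
    simp only [ψ, EW, toEuc_mul]
  let W : S2 × S2 → ℝ := fun z => ∑ k ∈ Finset.range N, (ρ⁻¹) ^ k * ψ k z.1.1 z.2.1
  have hC0 : 0 ≤ ∑ i, ‖toEuc (A i)‖ ^ 2 := by positivity
  have e1ne : e1 ≠ 0 := by
    intro h; have := congrArg (fun v : E2 => v 0) h; simp [e1] at this
  obtain ⟨U, hUo, hqU, F, hF, hcon⟩ := analytic_core (fun i => actS (A i))
    (fun i x => lr (A i) x.1) W q hq (ρ := ρ) (K := ∑ k ∈ Finset.range N, (ρ⁻¹) ^ k)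
    (C := ∑ i, ‖toEuc (A i)‖ ^ 2) hρ0 hρ1
    (fun z => Finset.sum_nonneg fun k _ => mul_nonneg (by positivity) (hψ0 _ _ _))
    (fun z => Finset.sum_le_sum fun k _ =>
      mul_le_of_le_one_right (by positivity) (hψ1 _ _ _))
    (by
      intro x y
      have h1 : ∑ i, q i * W (actS (A i) x, actS (A i) y) =
          ∑ k ∈ Finset.range N, (ρ⁻¹) ^ k * ψ (k+1) x.1 y.1 := by
        simp only [W, actS, Finset.mul_sum]
        rw [Finset.sum_comm]
        refine Finset.sum_congr rfl fun k _ => ?_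
        rw [← hψs, Finset.mul_sum]
        exact Finset.sum_congr rfl fun i _ => by ring
      have h2 := Finset.sum_range_succ (fun k => (ρ⁻¹) ^ k * ψ k x.1 y.1) N
      have h3 := Finset.sum_range_succ' (fun k => (ρ⁻¹) ^ k * ψ k x.1 y.1) N
      have h4 : ρ * ∑ k ∈ Finset.range N, (ρ⁻¹) ^ (k+1) * ψ (k+1) x.1 y.1 =
          ∑ k ∈ Finset.range N, (ρ⁻¹) ^ k * ψ (k+1) x.1 y.1 := by
        rw [Finset.mul_sum]
        refine Finset.sum_congr rfl fun k _ => ?_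
        rw [pow_succ]; field_simp
      have h5 : (ρ⁻¹) ^ N * ψ N x.1 y.1 ≤ ψ 0 x.1 y.1 := by
        rw [inv_pow, inv_mul_le_iff₀ (by positivity)]
        refine (hr x.1 y.1 x.2 y.2).trans ?_
        rw [hψz]
        exact mul_le_mul_of_nonneg_right hρN (Real.rpow_nonneg (dd_nonneg _ _) _)
      rw [h1, ← h4]
      refine mul_le_mul_of_nonneg_left ?_ hρ0.le
      simp only [pow_zero, one_mul] at h3
      change _ ≤ ∑ k ∈ Finset.range N, (ρ⁻¹) ^ k * ψ k x.1 y.1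
      linarith)
    hC0
    (by
      intro i x y
      refine (lr_lip (A i) x.2 y.2).trans ?_
      have h1 : ‖toEuc (A i)‖ ^ 2 ≤ ∑ i, ‖toEuc (A i)‖ ^ 2 :=
        Finset.single_le_sum (f := fun i => ‖toEuc (A i)‖ ^ 2) (fun i _ => by positivity)
          (Finset.mem_univ i)
      refine mul_le_mul h1 ?_ (dd_nonneg _ _) hC0
      have h2 : ψ 0 x.1 y.1 ≤ W (x, y) := by
        have := Finset.single_le_sum (f := fun k => (ρ⁻¹) ^ k * ψ k x.1 y.1)
          (s := Finset.range N) (fun k _ => mul_nonneg (by positivity) (hψ0 _ _ _))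
          (Finset.mem_range.2 hN)
        simpa [W] using this
      refine le_trans ?_ h2
      rw [hψz]
      calc dd x.1 y.1 = dd x.1 y.1 ^ (1 : ℝ) := (Real.rpow_one _).symm
        _ ≤ _ := Real.rpow_le_rpow_of_exponent_ge' (dd_nonneg _ _) (dd_le_one _ _) hα0.le hα1)
    ⟨e1, e1ne⟩
  refine ⟨U, hUo, hqU, F, hF, fun q' hq' hqp hqs => ?_⟩
  obtain ⟨C', hC'⟩ := hcon q' hq' hqp hqs
  refine ⟨C', fun n x hx => ?_⟩
  have := hC' n ⟨x, hx⟩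
  rwa [fS_eq A q' hqs] at this

end contraction
lemma lr_lower (g : SL2) {x s : E2} (hx : x ≠ 0) (hs : s ≠ 0)
    (h : ‖toEuc g‖ * |wd x s| ≤ 2 * (‖toEuc g x‖ * ‖s‖)) {δ : ℝ} (hδ : 0 < δ)
    (hd : δ ≤ dd x s) : Real.log ‖toEuc g‖ + Real.log (δ / 2) ≤ lr g x := by
  have h0 := norm_pos_iff.2 hx
  have h1 := norm_pos_iff.2 hs
  have hg := one_le_norm g
  rw [← Real.log_mul (by linarith) (by linarith)]
  refine Real.log_le_log (by positivity) ?_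
  rw [le_div_iff₀ h0]
  unfold dd at hd
  rw [le_div_iff₀ (by positivity)] at hd
  have h2 : ‖toEuc g‖ * (δ * (‖x‖ * ‖s‖)) ≤ 2 * (‖toEuc g x‖ * ‖s‖) :=
    (mul_le_mul_of_nonneg_left hd (by linarith)).trans h
  have h3 : (‖toEuc g‖ * (δ / 2) * ‖x‖) * ‖s‖ ≤ ‖toEuc g x‖ * ‖s‖ := by linarith
  exact le_of_mul_le_mul_right h3 h1

open Classical in
lemma lr_lower' (g : SL2) {s : E2} (hs : s ≠ 0)
    (h : ∀ x, ‖toEuc g‖ * |wd x s| ≤ 2 * (‖toEuc g x‖ * ‖s‖)) {δ : ℝ} (hδ : 0 < δ) (hδ1 : δ ≤ 1)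
    {x : E2} (hx : x ≠ 0) :
    Real.log ‖toEuc g‖ - 2 * Real.log ‖toEuc g‖ * (if dd x s < δ then 1 else 0)
      + Real.log (δ / 2) ≤ lr g x := by
  split_ifs with hd
  · have h1 := le_lr g hx
    have h2 : Real.log (δ / 2) ≤ 0 := Real.log_nonpos (by linarith) (by linarith)
    linarith
  · have := lr_lower g hx hs (h x) hδ (not_lt.1 hd)
    linarith

lemma nonneg_of_arch {t C : ℝ} (h : ∀ n : ℕ, - C ≤ n * t) : 0 ≤ t := by
  by_contra ht
  push Not at ht
  obtain ⟨n, hn⟩ := exists_nat_gt (C / (-t))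
  rw [div_lt_iff₀ (by linarith)] at hn
  have := h n
  linarith

def vj (j : ℕ) : E2 := !₂[1, (j : ℝ)]

lemma vj_ne (j : ℕ) : vj j ≠ 0 := by
  intro h; have := congrArg (fun v : E2 => v 0) h; simp [vj] at this

lemma vj_norm (m : ℕ) {j : ℕ} (hj : j < m) : ‖vj j‖ ≤ 1 + m := by
  refine le_of_abs_le (abs_le_of_sq_le_sq ?_ (by positivity))
  rw [nsq]
  have : (j : ℝ) < m := by exact_mod_cast hj
  have h0 : (0 : ℝ) ≤ j := by positivity
  simp [vj]
  nlinarith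

lemma vj_dd (m : ℕ) {i j : ℕ} (hi : i < m) (hj : j < m) (hij : i ≠ j) :
    1 / (1 + (m : ℝ)) ^ 2 ≤ dd (vj i) (vj j) := by
  have h1 := vj_norm m hi
  have h2 := vj_norm m hj
  have h3 := norm_pos_iff.2 (vj_ne i)
  have h4 := norm_pos_iff.2 (vj_ne j)
  have h5 : 1 ≤ |wd (vj i) (vj j)| := by
    have : wd (vj i) (vj j) = (((j : ℤ) - i : ℤ) : ℝ) := by simp [wd, vj]
    rw [this, ← Int.cast_abs]
    have : (1 : ℤ) ≤ |(j : ℤ) - i| := Int.one_le_abs (by omega)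
    exact_mod_cast this
  unfold dd
  apply div_le_div₀ (by positivity) h5 (by positivity)
  rw [sq]; gcongr

section lyapeq
variable {κ : ℕ} {q : Fin κ → ℝ} (hq : ∀ i, 0 < q i) (hq1 : ∑ i, q i = 1) (A : Fin κ → SL2)
include hq hq1

open Classical in
lemma sum_vj_lower (m : ℕ) : ∃ C : ℝ, ∀ n, ((m : ℝ) - 2) * aN q A n - C ≤
    ∑ j ∈ Finset.range m, EW q A n (fun B => lr B (vj j)) := by
  set δ : ℝ := 1 / (1 + (m : ℝ)) ^ 2 / 2 with hδ
  have hδ0 : 0 < δ := by positivity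
  have hδ1 : δ ≤ 1 := by
    have : 1 / (1 + (m : ℝ)) ^ 2 ≤ 1 := by
      rw [div_le_one (by positivity)]; nlinarith [(Nat.cast_nonneg m : (0 : ℝ) ≤ m)]
    rw [hδ]; linarith
  refine ⟨- (m * Real.log (δ / 2)), fun n => ?_⟩
  rw [← EW_sum]
  have h1 : EW q A n (fun B => ((m : ℝ) - 2) * Real.log ‖toEuc B‖ + m * Real.log (δ / 2)) ≤
      EW q A n (fun B => ∑ j ∈ Finset.range m, lr B (vj j)) := by
    refine EW_mono q hq A n fun B => ?_
    obtain ⟨s, hs, h⟩ := exists_contr B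
    have h2 : ∑ j ∈ Finset.range m, (Real.log ‖toEuc B‖ - 2 * Real.log ‖toEuc B‖ *
        (if dd (vj j) s < δ then 1 else 0) + Real.log (δ / 2)) ≤
        ∑ j ∈ Finset.range m, lr B (vj j) :=
      Finset.sum_le_sum fun j _ => lr_lower' B hs h hδ0 hδ1 (vj_ne j)
    rw [Finset.sum_add_distrib, Finset.sum_sub_distrib, ← Finset.mul_sum] at h2
    simp only [Finset.sum_const, Finset.card_range, nsmul_eq_mul] at h2
    have h3 : ∑ j ∈ Finset.range m, (if dd (vj j) s < δ then (1 : ℝ) else 0) ≤ 1 := by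
      rw [Finset.sum_boole]
      have : ((Finset.range m).filter fun j => dd (vj j) s < δ).card ≤ 1 := by
        rw [Finset.card_le_one]
        intro i hi j hj
        simp only [Finset.mem_filter, Finset.mem_range] at hi hj
        by_contra hij
        have h4 := vj_dd m hi.1 hj.1 hij
        have h5 := dd_tri (vj i) s (vj j) (vj_ne i) hs (vj_ne j)
        rw [dd_comm s] at h5
        have : 1 / (1 + (m : ℝ)) ^ 2 = 2 * δ := by rw [hδ]; ring
        linarith [hi.2, hj.2]
      exact_mod_cast this
    have h4 := log_norm_nonneg B
    nlinarith
  rw [EW_add, EW_mul, EW_const q hq1] at h1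
  unfold aN
  linarith

lemma lyap_eq_of_bound {F C : ℝ} (h : ∀ (n : ℕ) (x : E2), x ≠ 0 →
    |EW q A n (fun B => lr B x) - n * F| ≤ C) : F = lyapLC q A := by
  apply le_antisymm
  · refine le_lyap hq hq1 A (C := C) fun n => ?_
    have h1 := (abs_le.1 (h n (vj 0) (vj_ne 0))).1
    have h2 : EW q A n (fun B => lr B (vj 0)) ≤ aN q A n :=
      EW_mono q hq A n fun B => lr_le B (vj_ne 0)
    linarith
  · have hL : 0 ≤ lyapLC q A := by
      refine le_lyap hq hq1 A (C := 0) fun n => ?_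
      have := aN_nonneg hq hq1 A n
      linarith
    have key : ∀ m : ℕ, 0 ≤ (m : ℝ) * F - ((m : ℝ) - 2) * lyapLC q A := by
      intro m
      rcases lt_or_ge m 2 with hm | hm
      · have hF : 0 ≤ F := by
          obtain ⟨C1, hC1⟩ := sum_vj_lower hq hq1 A 2
          refine nonneg_of_arch (C := C1 / 2 + C) fun n => ?_
          have h1 := hC1 n
          simp only [Finset.sum_range_succ, Finset.sum_range_zero] at h1
          have h2 := (abs_le.1 (h n (vj 0) (vj_ne 0))).2
          have h3 := (abs_le.1 (h n (vj 1) (vj_ne 1))).2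
          push_cast at h1
          linarith
        have hm' : (m : ℝ) ≤ 2 := by exact_mod_cast hm.le
        have : 0 ≤ (m : ℝ) * F := by positivity
        nlinarith
      · obtain ⟨C1, hC1⟩ := sum_vj_lower hq hq1 A m
        refine nonneg_of_arch (C := C1 + m * C) fun n => ?_
        have h1 := hC1 n
        have h2 : ∑ j ∈ Finset.range m, EW q A n (fun B => lr B (vj j)) ≤
            ∑ j ∈ Finset.range m, (n * F + C) := by
          refine Finset.sum_le_sum fun j _ => ?_
          have := (abs_le.1 (h n (vj j) (vj_ne j))).2
          linarith
        simp only [Finset.sum_const, Finset.card_range, nsmul_eq_mul] at h2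
        have hm' : (2 : ℝ) ≤ m := by exact_mod_cast hm
        have h3 : ((m : ℝ) - 2) * (n * lyapLC q A) ≤ ((m : ℝ) - 2) * aN q A n := by
          refine mul_le_mul_of_nonneg_left ?_ (by linarith)
          rcases Nat.eq_zero_or_pos n with h0 | h0
          · subst h0; have := aN_nonneg hq hq1 A 0; simpa using this
          · exact lyap_le_aN hq hq1 A n h0
        linarith
    have := nonneg_of_arch (t := F - lyapLC q A) (C := 2 * lyapLC q A) fun m => by
      have := key m; linarith
    linarith

end lyapeq
/-! ### Invariant means and the dichotomy -/

def Bd (h : E2 → ℝ) : Prop := ∃ C : ℝ, ∀ x, x ≠ 0 → |h x| ≤ C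

structure IsMean {κ : ℕ} (p : Fin κ → ℝ) (A : Fin κ → SL2) (Λ : (E2 → ℝ) → ℝ) : Prop where
  add : ∀ h k, Bd h → Bd k → Λ (fun x => h x + k x) = Λ h + Λ k
  smul : ∀ (c : ℝ) h, Bd h → Λ (fun x => c * h x) = c * Λ h
  mono : ∀ h k, Bd h → Bd k → (∀ x, x ≠ 0 → h x ≤ k x) → Λ h ≤ Λ k
  const : ∀ c : ℝ, Λ (fun _ => c) = c
  inv : ∀ h, Bd h → Λ (fun x => ∑ i, p i * h (toEuc (A i) x)) = Λ h
  drift : Λ (fun x => ∑ i, p i * lr (A i) x) ≤ 0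

open Filter Topology in
lemma exists_ulim {u : ℕ → ℝ} {C : ℝ} (h : ∀ n, |u n| ≤ C) :
    Tendsto u (hyperfilter ℕ : Filter ℕ) (𝓝 (limUnder (hyperfilter ℕ : Filter ℕ) u)) := by
  have h1 : ((hyperfilter ℕ).map u : Filter ℝ) ≤ 𝓟 (Set.Icc (-C) C) := by
    rw [le_principal_iff]
    exact Filter.Eventually.of_forall (f := (hyperfilter ℕ : Filter ℕ)) fun n => abs_le.1 (h n)
  obtain ⟨l, _, hl⟩ := (isCompact_Icc (a := -C) (b := C)).ultrafilter_le_nhds _ h1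
  exact tendsto_nhds_limUnder ⟨l, hl⟩

lemma Bd.add {h k : E2 → ℝ} (hh : Bd h) (hk : Bd k) : Bd (fun x => h x + k x) := by
  obtain ⟨C, hC⟩ := hh
  obtain ⟨D, hD⟩ := hk
  exact ⟨C + D, fun x hx => (abs_add_le _ _).trans (add_le_add (hC x hx) (hD x hx))⟩

lemma Bd.smul {h : E2 → ℝ} (c : ℝ) (hh : Bd h) : Bd (fun x => c * h x) := by
  obtain ⟨C, hC⟩ := hh
  exact ⟨|c| * C, fun x hx => by
    rw [abs_mul]; exact mul_le_mul_of_nonneg_left (hC x hx) (abs_nonneg _)⟩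

lemma Bd.const (c : ℝ) : Bd (fun _ => c) := ⟨|c|, fun _ _ => le_rfl⟩

lemma Bd.sum {ι : Type*} (s : Finset ι) (h : ι → E2 → ℝ) (hh : ∀ i, Bd (h i)) :
    Bd (fun x => ∑ i ∈ s, h i x) := by
  choose C hC using hh
  exact ⟨∑ i ∈ s, C i, fun x hx => (Finset.abs_sum_le_sum_abs _ _).trans
    (Finset.sum_le_sum fun i _ => hC i x hx)⟩

lemma Bd.comp {h : E2 → ℝ} (hh : Bd h) (g : SL2) : Bd (fun x => h (toEuc g x)) := by
  obtain ⟨C, hC⟩ := hh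
  exact ⟨C, fun x hx => hC _ (act_ne_zero g hx)⟩

lemma Bd.lr (g : SL2) : Bd (lr g) :=
  ⟨Real.log ‖toEuc g‖, fun _ hx => abs_le.2 ⟨le_lr g hx, lr_le g hx⟩⟩

lemma Bd.EW {κ : ℕ} (p : Fin κ → ℝ) (A : Fin κ → SL2) (n : ℕ) (H : SL2 → E2 → ℝ)
    (hH : ∀ B, Bd (H B)) : Bd (fun x => EW p A n (fun B => H B x)) := by
  have : (fun x => _root_.EW p A n (fun B => H B x)) = fun x =>
    ∑ w : Fin n → Fin κ, (∏ i, p (w i)) * H (wordProd A w) x := by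
    funext x; rw [EW_eq]
  rw [this]
  exact Bd.sum _ _ fun w => (hH _).smul _

lemma IsMean.sum {κ : ℕ} {p : Fin κ → ℝ} {A : Fin κ → SL2} {Λ : (E2 → ℝ) → ℝ}
    (hΛ : IsMean p A Λ) {ι : Type*} (s : Finset ι) (h : ι → E2 → ℝ) (hh : ∀ i, Bd (h i)) :
    Λ (fun x => ∑ i ∈ s, h i x) = ∑ i ∈ s, Λ (h i) := by
  classical
  induction s using Finset.induction_on with
  | empty => simpa using hΛ.const 0
  | insert a s ha ih =>
    simp only [Finset.sum_insert ha]
    rw [hΛ.add _ _ (hh a) (Bd.sum _ _ hh), ih]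

lemma IsMean.EW {κ : ℕ} {p : Fin κ → ℝ} {A : Fin κ → SL2} {Λ : (E2 → ℝ) → ℝ}
    (hΛ : IsMean p A Λ) (n : ℕ) (H : SL2 → E2 → ℝ) (hH : ∀ B, Bd (H B)) :
    Λ (fun x => EW p A n (fun B => H B x)) = EW p A n (fun B => Λ (H B)) := by
  have : (fun x => _root_.EW p A n (fun B => H B x)) = fun x =>
    ∑ w : Fin n → Fin κ, (∏ i, p (w i)) * H (wordProd A w) x := by
    funext x; rw [EW_eq]
  rw [this, hΛ.sum _ _ fun w => (hH _).smul _, EW_eq]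
  exact Finset.sum_congr rfl fun w _ => hΛ.smul _ _ (hH _)

lemma EW_lr_succ {κ : ℕ} {p : Fin κ → ℝ} (hp1 : ∑ i, p i = 1) (A : Fin κ → SL2) (n : ℕ)
    {x : E2} (hx : x ≠ 0) : EW p A (n+1) (fun B => lr B x) =
      EW p A n (fun B => lr B x) + EW p A n (fun B => ∑ i, p i * lr (A i) (toEuc B x)) := by
  rw [EW_left, ← EW_add]
  congr 1
  funext B
  simp only [lr_mul _ _ hx, mul_add, Finset.sum_add_distrib]
  rw [← Finset.sum_mul, hp1]; ring

lemma EW_lr_eq_sum {κ : ℕ} {p : Fin κ → ℝ} (hp1 : ∑ i, p i = 1) (A : Fin κ → SL2) (n : ℕ)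
    {x : E2} (hx : x ≠ 0) : EW p A n (fun B => lr B x) =
      ∑ k ∈ Finset.range n, EW p A k (fun B => ∑ i, p i * lr (A i) (toEuc B x)) := by
  induction n with
  | zero => simp [EW, lr_one]
  | succ n ih => rw [EW_lr_succ hp1 A n hx, Finset.sum_range_succ, ih]

open Filter Topology in
lemma exists_mean {κ : ℕ} {p : Fin κ → ℝ} (hp : ∀ i, 0 < p i) (hp1 : ∑ i, p i = 1)
    (A : Fin κ → SL2) (hS : ¬ StarC p A) : ∃ Λ, IsMean p A Λ := by
  have hx : ∀ n : ℕ, ∃ x : E2, x ≠ 0 ∧ EW p A n (fun B => lr B x) < 1 := by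
    intro n
    by_contra hcon
    push Not at hcon
    exact hS ⟨n, 1, one_pos, hcon⟩
  choose x hx0 hx1 using hx
  obtain ⟨M, hM⟩ : ∃ M : (E2 → ℝ) → ℕ → ℝ, ∀ h n, M h n =
    (n : ℝ)⁻¹ * ∑ k ∈ Finset.range n, EW p A k (fun B => h (toEuc B (x n))) := ⟨_, fun _ _ => rfl⟩
  have hEb : ∀ (h : E2 → ℝ) (C : ℝ), (∀ x, x ≠ 0 → |h x| ≤ C) → ∀ k (y : E2), y ≠ 0 →
      |EW p A k (fun B => h (toEuc B y))| ≤ C := by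
    intro h C hC k y hy
    rw [abs_le]
    constructor
    · rw [← EW_const p hp1 A k (-C)]
      exact EW_mono p hp A k fun B => (abs_le.1 (hC _ (act_ne_zero B hy))).1
    · conv_rhs => rw [← EW_const p hp1 A k C]
      exact EW_mono p hp A k fun B => (abs_le.1 (hC _ (act_ne_zero B hy))).2
  have hMb : ∀ h, Bd h → ∃ C, ∀ n, |M h n| ≤ C := by
    rintro h ⟨C, hC⟩
    have hC0 : 0 ≤ C := (abs_nonneg _).trans (hC _ (vj_ne 0))
    refine ⟨C, fun n => ?_⟩
    rcases Nat.eq_zero_or_pos n with h0 | h0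
    · subst h0; simpa [hM] using hC0
    have hn : (0 : ℝ) < n := by exact_mod_cast h0
    simp only [hM]
    rw [abs_mul, abs_of_nonneg (by positivity), inv_mul_le_iff₀ hn]
    refine (Finset.abs_sum_le_sum_abs _ _).trans ?_
    refine (Finset.sum_le_sum fun k _ => hEb h C hC k (x n) (hx0 n)).trans ?_
    simp
  obtain ⟨Λ, hΛ⟩ : ∃ Λ : (E2 → ℝ) → ℝ, ∀ h, Bd h →
      Tendsto (M h) (hyperfilter ℕ : Filter ℕ) (𝓝 (Λ h)) := by
    refine ⟨fun h => limUnder (hyperfilter ℕ : Filter ℕ) (M h), fun h hh => ?_⟩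
    obtain ⟨C, hC⟩ := hMb h hh
    exact exists_ulim hC
  have hinv : Tendsto (fun n : ℕ => (n : ℝ)⁻¹) (hyperfilter ℕ : Filter ℕ) (𝓝 0) :=
    (tendsto_inv_atTop_nhds_zero_nat (𝕜 := ℝ)).mono_left Nat.hyperfilter_le_atTop
  have hpos : ∀ᶠ n : ℕ in (hyperfilter ℕ : Filter ℕ), 0 < n :=
    (eventually_gt_atTop 0).filter_mono Nat.hyperfilter_le_atTop
  refine ⟨Λ, ?_, ?_, ?_, ?_, ?_, ?_⟩
  · intro h k hh hk
    refine tendsto_nhds_unique (hΛ _ (hh.add hk)) ?_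
    refine ((hΛ h hh).add (hΛ k hk)).congr fun n => ?_
    simp only [hM]
    rw [← mul_add, ← Finset.sum_add_distrib]
    congr 1
    exact Finset.sum_congr rfl fun j _ => (EW_add p A j _ _).symm
  · intro c h hh
    refine tendsto_nhds_unique (hΛ _ (hh.smul c)) ?_
    refine ((hΛ h hh).const_mul c).congr fun n => ?_
    simp only [hM]
    rw [mul_left_comm, Finset.mul_sum]
    congr 1
    exact Finset.sum_congr rfl fun j _ => (EW_mul p A j _ _).symm
  · intro h k hh hk hle
    refine le_of_tendsto_of_tendsto' (hΛ h hh) (hΛ k hk) fun n => ?_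
    simp only [hM]
    refine mul_le_mul_of_nonneg_left ?_ (by positivity)
    exact Finset.sum_le_sum fun j _ => EW_mono p hp A j fun B => hle _ (act_ne_zero B (hx0 n))
  · intro c
    refine tendsto_nhds_unique (hΛ _ (Bd.const c)) ?_
    refine Tendsto.congr' ?_ tendsto_const_nhds
    filter_upwards [hpos] with n hn
    have : (n : ℝ) ≠ 0 := by exact_mod_cast hn.ne'
    simp only [hM, EW_const p hp1]
    simp [this]
  · intro h hh
    have hQ : Bd (fun x => ∑ i, p i * h (toEuc (A i) x)) :=
      Bd.sum _ _ fun i => (hh.comp (A i)).smul _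
    obtain ⟨C, hC⟩ := hh
    have hd : Tendsto (fun n => M (fun x => ∑ i, p i * h (toEuc (A i) x)) n - M h n)
        (hyperfilter ℕ : Filter ℕ) (𝓝 0) := by
      have h2 : Tendsto (fun n : ℕ => (n : ℝ)⁻¹ * (2 * C)) (hyperfilter ℕ : Filter ℕ) (𝓝 0) := by
        simpa using hinv.mul_const (2 * C)
      refine squeeze_zero_norm (fun n => ?_) h2
      simp only [hM]
      rw [← mul_sub, ← Finset.sum_sub_distrib, Real.norm_eq_abs, abs_mul,
        abs_of_nonneg (by positivity)]
      refine mul_le_mul_of_nonneg_left ?_ (by positivity)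
      have e : ∑ k ∈ Finset.range n, (EW p A k (fun B => ∑ i, p i * h (toEuc (A i) (toEuc B (x n))))
          - EW p A k (fun B => h (toEuc B (x n)))) =
          EW p A n (fun B => h (toEuc B (x n))) - EW p A 0 (fun B => h (toEuc B (x n))) := by
        rw [← Finset.sum_range_sub (fun k => EW p A k (fun B => h (toEuc B (x n))))]
        refine Finset.sum_congr rfl fun k _ => ?_
        rw [EW_left]
        simp only [toEuc_mul]
      rw [e]
      have a1 := abs_le.1 (hEb h C hC n (x n) (hx0 n))
      have a2 := abs_le.1 (hEb h C hC 0 (x n) (hx0 n))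
      rw [abs_le]; constructor <;> linarith [a1.1, a1.2, a2.1, a2.2]
    have h3 := (hΛ _ hQ).sub (hΛ h ⟨C, hC⟩)
    have := tendsto_nhds_unique h3 hd
    linarith
  · have hb : Bd (fun x => ∑ i, p i * lr (A i) x) := Bd.sum _ _ fun i => (Bd.lr (A i)).smul _
    refine le_of_tendsto_of_tendsto' (hΛ _ hb) hinv fun n => ?_
    simp only [hM]
    rw [← EW_lr_eq_sum hp1 A n (hx0 n)]
    have := mul_le_mul_of_nonneg_left (hx1 n).le (by positivity : 0 ≤ (n : ℝ)⁻¹)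
    simpa using this
open Classical in
/-- indicator of the projective ball -/
def ind (v : E2) (δ : ℝ) (x : E2) : ℝ := if dd x v < δ then 1 else 0

lemma ind_nonneg (v : E2) (δ : ℝ) (x : E2) : 0 ≤ ind v δ x := by
  unfold ind; split_ifs <;> norm_num

lemma ind_le_one (v : E2) (δ : ℝ) (x : E2) : ind v δ x ≤ 1 := by
  unfold ind; split_ifs <;> norm_num

lemma Bd.ind (v : E2) (δ : ℝ) : Bd (ind v δ) :=
  ⟨1, fun x _ => by rw [abs_of_nonneg (ind_nonneg v δ x)]; exact ind_le_one v δ x⟩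

lemma ind_le_ind {v w x y : E2} {δ ε : ℝ} (h : dd x v < δ → dd y w < ε) :
    ind v δ x ≤ ind w ε y := by
  unfold ind
  by_cases h1 : dd x v < δ
  · rw [if_pos h1, if_pos (h h1)]
  · rw [if_neg h1]; split_ifs <;> norm_num

lemma dd_smul_right (x v : E2) {c : ℝ} (hc : c ≠ 0) : dd x (c • v) = dd x v := by
  unfold dd
  have h : wd x (c • v) = c * wd x v := by simp [wd]; ring
  rw [h, abs_mul, norm_smul, Real.norm_eq_abs]
  have : 0 < |c| := abs_pos.2 hc
  rw [show ‖x‖ * (|c| * ‖v‖) = |c| * (‖x‖ * ‖v‖) by ring, mul_div_mul_left _ _ this.ne']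

section means
variable {κ : ℕ} {p : Fin κ → ℝ} {A : Fin κ → SL2} {Λ : (E2 → ℝ) → ℝ} (hΛ : IsMean p A Λ)
include hΛ

lemma mean_lr (hp1 : ∑ i, p i = 1) (m : ℕ) : Λ (fun x => EW p A m (fun B => lr B x)) ≤ 0 := by
  have hb : ∀ n, Bd (fun x => EW p A n (fun B => lr B x)) := fun n =>
    Bd.EW p A n lr Bd.lr
  have hd : Bd (fun x => ∑ i, p i * lr (A i) x) := Bd.sum _ _ fun i => (Bd.lr (A i)).smul _
  induction m with
  | zero =>
    simp only [EW, lr_one]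
    exact (hΛ.const 0).le
  | succ m ih =>
    have hQ : Bd (fun x => ∑ i, p i * EW p A m (fun B => lr B (toEuc (A i) x))) :=
      Bd.sum _ _ fun i => ((hb m).comp (A i)).smul _
    have h1 : Λ (fun x => EW p A (m+1) (fun B => lr B x)) ≤
        Λ (fun x => (∑ i, p i * EW p A m (fun B => lr B (toEuc (A i) x))) +
          ∑ i, p i * lr (A i) x) := by
      refine hΛ.mono _ _ (hb (m+1)) (hQ.add hd) fun x hx => ?_
      rw [EW, ← Finset.sum_add_distrib]
      refine le_of_eq (Finset.sum_congr rfl fun i _ => ?_)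
      simp only [lr_mul _ _ hx]
      rw [EW_add, EW_const p hp1]; ring
    rw [hΛ.add _ _ hQ hd, hΛ.inv _ (hb m)] at h1
    linarith [hΛ.drift]

lemma exists_heavy (hp : ∀ i, 0 < p i) (hp1 : ∑ i, p i = 1) (hL : 0 < lyapLC p A) {δ ε : ℝ}
    (hδ : 0 < δ) (hδ1 : δ ≤ 1) (hε : 0 < ε) : ∃ v : E2, v ≠ 0 ∧ 1 / 2 - ε < Λ (ind v δ) := by
  by_contra hcon
  push Not at hcon
  choose s hs hsc using exists_contr
  have hb : ∀ B : SL2, Bd (fun x => (Real.log ‖toEuc B‖ + Real.log (δ / 2)) +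
      (-(2 * Real.log ‖toEuc B‖)) * ind (s B) δ x) := fun B =>
    (Bd.const _).add ((Bd.ind _ _).smul _)
  have key : ∀ m : ℕ, 2 * ε * aN p A m + Real.log (δ / 2) ≤ 0 := by
    intro m
    have h1 := mean_lr hΛ hp1 m
    have h2 : Λ (fun x => EW p A m (fun B => (Real.log ‖toEuc B‖ + Real.log (δ / 2)) +
      (-(2 * Real.log ‖toEuc B‖)) * ind (s B) δ x)) ≤ Λ (fun x => EW p A m (fun B => lr B x)) := by
      refine hΛ.mono _ _ (Bd.EW p A m _ hb) (Bd.EW p A m lr Bd.lr) fun x hx => ?_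
      refine EW_mono p hp A m fun B => ?_
      have := lr_lower' B (hs B) (hsc B) hδ hδ1 hx
      unfold ind
      linarith
    rw [hΛ.EW m _ hb] at h2
    have h3 : EW p A m (fun B => 2 * ε * Real.log ‖toEuc B‖ + Real.log (δ / 2)) ≤
        EW p A m (fun B => Λ (fun x => (Real.log ‖toEuc B‖ + Real.log (δ / 2)) +
      (-(2 * Real.log ‖toEuc B‖)) * ind (s B) δ x)) := by
      refine EW_mono p hp A m fun B => ?_
      rw [hΛ.add _ _ (Bd.const _) ((Bd.ind _ _).smul _), hΛ.const, hΛ.smul _ _ (Bd.ind _ _)]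
      have h4 := hcon (s B) (hs B)
      have h5 := log_norm_nonneg B
      nlinarith
    rw [EW_add, EW_mul, EW_const p hp1] at h3
    unfold aN
    linarith
  have : 0 ≤ - (2 * ε * lyapLC p A) := by
    refine nonneg_of_arch (C := - Real.log (δ / 2)) fun n => ?_
    have h1 := key n
    have h2 : n * lyapLC p A ≤ aN p A n := by
      rcases Nat.eq_zero_or_pos n with h0 | h0
      · subst h0; have := aN_nonneg hp hp1 A 0; simpa using this
      · exact lyap_le_aN hp hp1 A n h0
    have h3 := mul_le_mul_of_nonneg_left h2 (by positivity : 0 ≤ 2 * ε)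
    linarith
  have : 0 < 2 * ε * lyapLC p A := by positivity
  linarith

open Filter Topology in
lemma exists_half (hp : ∀ i, 0 < p i) (hp1 : ∑ i, p i = 1) (hL : 0 < lyapLC p A) :
    ∃ v : E2, v ≠ 0 ∧ ∀ δ, 0 < δ → 1 / 2 ≤ Λ (ind v δ) := by
  have h1 : ∀ k : ℕ, ∃ v : E2, v ∈ Metric.sphere (0 : E2) 1 ∧
      1 / 2 - 1 / ((k : ℝ) + 1) < Λ (ind v (1 / ((k : ℝ) + 1))) := by
    intro k
    have hk : (0 : ℝ) < 1 / ((k : ℝ) + 1) := by positivity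
    have hk1 : 1 / ((k : ℝ) + 1) ≤ 1 := by
      rw [div_le_one (by positivity)]; linarith [(Nat.cast_nonneg k : (0 : ℝ) ≤ k)]
    obtain ⟨v, hv, h⟩ := exists_heavy hΛ hp hp1 hL hk hk1 hk
    have hv0 := norm_pos_iff.2 hv
    refine ⟨‖v‖⁻¹ • v, ?_, ?_⟩
    · simp [norm_smul, hv0.ne']
    · have : ind (‖v‖⁻¹ • v) (1 / ((k : ℝ) + 1)) = ind v (1 / ((k : ℝ) + 1)) := by
        funext x; unfold ind; rw [dd_smul_right _ _ (inv_ne_zero hv0.ne')]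
      rw [this]; exact h
  choose v hv hvl using h1
  obtain ⟨w, hw, φ, hφ, hlim⟩ := (isCompact_sphere (0 : E2) 1).tendsto_subseq hv
  have hn : ∀ {u : E2}, u ∈ Metric.sphere (0 : E2) 1 → u ≠ 0 := by
    intro u hu h
    rw [h] at hu; simp at hu
  refine ⟨w, hn hw, fun δ hδ => ?_⟩
  have hd : Tendsto (fun k => dd (v (φ k)) w) atTop (𝓝 0) := by
    have e : ∀ k, dd (v (φ k)) w = |wd (v (φ k)) w| := by
      intro k
      have a1 : ‖v (φ k)‖ = 1 := by simpa using hv (φ k)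
      have a2 : ‖w‖ = 1 := by simpa using hw
      rw [dd, a1, a2]; simp
    simp only [e]
    have hc : Continuous fun y : E2 => |wd y w| := by unfold wd; fun_prop
    have := (hc.tendsto w).comp hlim
    have e0 : |wd w w| = 0 := by unfold wd; simp [mul_comm]
    rw [e0] at this
    exact this
  have hk : Tendsto (fun k => 1 / ((φ k : ℝ) + 1)) atTop (𝓝 0) :=
    (tendsto_one_div_add_atTop_nhds_zero_nat (𝕜 := ℝ)).comp hφ.tendsto_atTop
  have hk2 : Tendsto (fun k => 1 / 2 - 1 / ((φ k : ℝ) + 1)) atTop (𝓝 (1 / 2)) := by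
    have := hk.const_sub (1 / 2 : ℝ)
    rwa [sub_zero] at this
  refine le_of_tendsto hk2 ?_
  filter_upwards [hd.eventually_lt_const (half_pos hδ), hk.eventually_lt_const (half_pos hδ)]
    with k a b
  refine (hvl (φ k)).le.trans (hΛ.mono _ _ (Bd.ind _ _) (Bd.ind _ _) fun x hx => ?_)
  refine ind_le_ind fun c => ?_
  have := dd_tri x (v (φ k)) w hx (hn (hv _)) (hn hw)
  linarith

end means

/-- mass of a line -/
def mass (Λ : (E2 → ℝ) → ℝ) (v : E2) : ℝ := ⨅ k : ℕ, Λ (ind v (1 / ((k : ℝ) + 1)))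

section means
variable {κ : ℕ} {p : Fin κ → ℝ} {A : Fin κ → SL2} {Λ : (E2 → ℝ) → ℝ} (hΛ : IsMean p A Λ)
include hΛ

lemma lam_nonneg (v : E2) (δ : ℝ) : 0 ≤ Λ (ind v δ) := by
  have := hΛ.mono _ _ (Bd.const 0) (Bd.ind v δ) fun x _ => ind_nonneg v δ x
  rwa [hΛ.const] at this

lemma lam_mono (v : E2) {δ ε : ℝ} (h : δ ≤ ε) : Λ (ind v δ) ≤ Λ (ind v ε) :=
  hΛ.mono _ _ (Bd.ind _ _) (Bd.ind _ _) fun _ _ => ind_le_ind fun a => a.trans_le h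

lemma mass_bdd (v : E2) : BddBelow (Set.range fun k : ℕ => Λ (ind v (1 / ((k : ℝ) + 1)))) :=
  ⟨0, by rintro _ ⟨k, rfl⟩; exact lam_nonneg hΛ v _⟩

lemma mass_nonneg (v : E2) : 0 ≤ mass Λ v := le_ciInf fun _ => lam_nonneg hΛ v _

lemma mass_le (v : E2) {δ : ℝ} (hδ : 0 < δ) : mass Λ v ≤ Λ (ind v δ) := by
  obtain ⟨k, hk⟩ := exists_nat_one_div_lt hδ
  exact (ciInf_le (mass_bdd hΛ v) k).trans (lam_mono hΛ v hk.le)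

lemma mass_approx (v : E2) {ε : ℝ} (hε : 0 < ε) : ∃ δ, 0 < δ ∧ Λ (ind v δ) < mass Λ v + ε := by
  obtain ⟨k, hk⟩ := exists_lt_of_ciInf_lt (f := fun k : ℕ => Λ (ind v (1 / ((k : ℝ) + 1))))
    (a := mass Λ v + ε) (lt_add_of_pos_right _ hε)
  exact ⟨_, by positivity, hk⟩

omit hΛ in
lemma mass_smul (v : E2) {c : ℝ} (hc : c ≠ 0) : mass Λ (c • v) = mass Λ v := by
  unfold mass
  congr 1
  funext k
  congr 1
  funext x; unfold ind; rw [dd_smul_right _ _ hc]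

omit hΛ in
lemma dd_pos {v w : E2} (h : wd v w ≠ 0) : 0 < dd v w := by
  have hv : v ≠ 0 := by rintro rfl; apply h; simp [wd]
  have hw : w ≠ 0 := by rintro rfl; apply h; simp [wd]
  have h1 := norm_pos_iff.2 hv
  have h2 := norm_pos_iff.2 hw
  have := abs_pos.2 h
  unfold dd; positivity

omit hΛ in
lemma ind_disj {v w x : E2} (hv : v ≠ 0) (hw : w ≠ 0) (hx : x ≠ 0) {δ : ℝ}
    (h : 2 * δ ≤ dd v w) : ¬ (dd x v < δ ∧ dd x w < δ) := by
  rintro ⟨a, b⟩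
  have := dd_tri v x w hv hx hw
  rw [dd_comm v x] at this
  linarith

lemma mass_three {u v w : E2} (h1 : wd u v ≠ 0) (h2 : wd u w ≠ 0) (h3 : wd v w ≠ 0) :
    mass Λ u + mass Λ v + mass Λ w ≤ 1 := by
  have hu : u ≠ 0 := by rintro rfl; apply h1; simp [wd]
  have hv : v ≠ 0 := by rintro rfl; apply h3; simp [wd]
  have hw : w ≠ 0 := by rintro rfl; apply h2; simp [wd]
  have d1 := dd_pos h1
  have d2 := dd_pos h2
  have d3 := dd_pos h3
  obtain ⟨δ, hδ, a1, a2, a3⟩ : ∃ δ : ℝ, 0 < δ ∧ 2 * δ ≤ dd u v ∧ 2 * δ ≤ dd u w ∧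
      2 * δ ≤ dd v w := by
    refine ⟨min (dd u v) (min (dd u w) (dd v w)) / 2, by positivity, ?_, ?_, ?_⟩
    · have := min_le_left (dd u v) (min (dd u w) (dd v w)); linarith
    · have := (min_le_right (dd u v) (min (dd u w) (dd v w))).trans (min_le_left _ _); linarith
    · have := (min_le_right (dd u v) (min (dd u w) (dd v w))).trans (min_le_right _ _); linarith
  have h := hΛ.mono _ _ (((Bd.ind u δ).add (Bd.ind v δ)).add (Bd.ind w δ)) (Bd.const 1)
    fun x hx => by
      have b1 := ind_disj hu hv hx a1
      have b2 := ind_disj hu hw hx a2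
      have b3 := ind_disj hv hw hx a3
      unfold ind
      split_ifs <;> first | (exfalso; tauto) | norm_num
  rw [hΛ.const, hΛ.add _ _ ((Bd.ind u δ).add (Bd.ind v δ)) (Bd.ind w δ),
    hΛ.add _ _ (Bd.ind u δ) (Bd.ind v δ)] at h
  linarith [mass_le hΛ u hδ, mass_le hΛ v hδ, mass_le hΛ w hδ]

lemma mass_two {u v : E2} (h1 : wd u v ≠ 0) : mass Λ u + mass Λ v ≤ 1 := by
  have h2 : wd u (u + v) ≠ 0 := by
    have : wd u (u + v) = wd u v := by simp [wd]; ring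
    rwa [this]
  have h3 : wd v (u + v) ≠ 0 := by
    have : wd v (u + v) = - wd u v := by simp [wd]; ring
    rw [this]; exact neg_ne_zero.2 h1
  linarith [mass_three hΛ h1 h2 h3, mass_nonneg hΛ (u + v)]

omit hΛ in
lemma toEuc_inv_apply (g : SL2) (x : E2) : toEuc g (toEuc g⁻¹ x) = x := by
  rw [← toEuc_mul, mul_inv_cancel, toEuc_one]

omit hΛ in
lemma dd_pull (g : SL2) {x v : E2} (hx : x ≠ 0) (hv : v ≠ 0) :
    dd x (toEuc g⁻¹ v) ≤ ‖toEuc g‖ ^ 2 * dd (toEuc g x) v := by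
  have h1 := dd_act g hx (act_ne_zero g⁻¹ hv)
  rw [toEuc_inv_apply] at h1
  have hg := one_le_norm g
  have aux : ∀ y : E2, y ≠ 0 → 1 ≤ ‖toEuc g‖ * Real.exp (- lr g y) := by
    intro y hy
    have h2 : Real.exp (- Real.log ‖toEuc g‖) ≤ Real.exp (- lr g y) :=
      Real.exp_le_exp.2 (neg_le_neg (lr_le g hy))
    rw [Real.exp_neg, Real.exp_log (by linarith)] at h2
    have h3 := mul_le_mul_of_nonneg_left h2 (by linarith : 0 ≤ ‖toEuc g‖)
    rwa [mul_inv_cancel₀ (by linarith)] at h3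
  rw [h1]
  have b1 := aux x hx
  have b2 := aux _ (act_ne_zero g⁻¹ hv)
  have b3 : 1 ≤ (‖toEuc g‖ * Real.exp (- lr g x)) * (‖toEuc g‖ * Real.exp (- lr g (toEuc g⁻¹ v))) :=
    one_le_mul_of_one_le_of_one_le b1 b2
  have b4 := mul_le_mul_of_nonneg_left b3 (dd_nonneg x (toEuc g⁻¹ v))
  linarith

lemma mass_inv (hp : ∀ i, 0 < p i) (hp1 : ∑ i, p i = 1) {v : E2} (hv : v ≠ 0) :
    mass Λ v ≤ ∑ i, p i * mass Λ (toEuc (A i)⁻¹ v) := by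
  refine le_of_forall_pos_le_add fun ε hε => ?_
  choose δ hδ hδm using fun i => mass_approx hΛ (toEuc (A i)⁻¹ v) hε
  obtain ⟨η, hη, hηi⟩ : ∃ η : ℝ, 0 < η ∧ ∀ i, ‖toEuc (A i)‖ ^ 2 * η ≤ δ i := by
    have h1 : ∀ i, 0 < δ i / ‖toEuc (A i)‖ ^ 2 := fun i => by
      have := one_le_norm (A i); have := hδ i; positivity
    have h2 : ∃ η : ℝ, 0 < η ∧ ∀ i, η ≤ δ i / ‖toEuc (A i)‖ ^ 2 := by
      rcases isEmpty_or_nonempty (Fin κ) with h | h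
      · exact ⟨1, one_pos, fun i => h.elim i⟩
      · obtain ⟨i, hi⟩ := Finite.exists_min fun i => δ i / ‖toEuc (A i)‖ ^ 2
        exact ⟨_, h1 i, hi⟩
    obtain ⟨η, hη, h3⟩ := h2
    refine ⟨η, hη, fun i => ?_⟩
    have := one_le_norm (A i)
    have h4 := h3 i
    rw [le_div_iff₀ (by positivity)] at h4
    linarith
  calc mass Λ v ≤ Λ (ind v η) := mass_le hΛ v hη
    _ = Λ (fun x => ∑ i, p i * ind v η (toEuc (A i) x)) := (hΛ.inv _ (Bd.ind v η)).symm
    _ = ∑ i, p i * Λ (fun x => ind v η (toEuc (A i) x)) := by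
        rw [hΛ.sum _ _ fun i => ((Bd.ind v η).comp (A i)).smul _]
        exact Finset.sum_congr rfl fun i _ => hΛ.smul _ _ ((Bd.ind v η).comp (A i))
    _ ≤ ∑ i, p i * (mass Λ (toEuc (A i)⁻¹ v) + ε) := by
        refine Finset.sum_le_sum fun i _ => mul_le_mul_of_nonneg_left ?_ (hp i).le
        refine le_trans ?_ (hδm i).le
        refine hΛ.mono _ _ ((Bd.ind v η).comp (A i)) (Bd.ind _ _) fun x hx => ?_
        refine ind_le_ind fun a => ?_
        have h1 := dd_pull (A i) hx hv
        have h2 := one_le_norm (A i)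
        have h3 : ‖toEuc (A i)‖ ^ 2 * dd (toEuc (A i) x) v < ‖toEuc (A i)‖ ^ 2 * η := by
          gcongr
        linarith [hηi i]
    _ = _ := by
        simp only [mul_add, Finset.sum_add_distrib]
        rw [← Finset.sum_mul, hp1, one_mul]

lemma mass_max (hp : ∀ i, 0 < p i) (hp1 : ∑ i, p i = 1) {v : E2} (hv : v ≠ 0)
    (hmax : ∀ w : E2, w ≠ 0 → mass Λ w ≤ mass Λ v) (i : Fin κ) :
    mass Λ (toEuc (A i)⁻¹ v) = mass Λ v := by
  refine le_antisymm (hmax _ (act_ne_zero _ hv)) ?_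
  by_contra hlt
  push Not at hlt
  have h1 := mass_inv hΛ hp hp1 hv
  have h2 : ∑ i, p i * mass Λ (toEuc (A i)⁻¹ v) < ∑ i, p i * mass Λ v :=
    Finset.sum_lt_sum (fun j _ => mul_le_mul_of_nonneg_left (hmax _ (act_ne_zero _ hv)) (hp j).le)
      ⟨i, Finset.mem_univ i, mul_lt_mul_of_pos_left hlt (hp i)⟩
  rw [← Finset.sum_mul, hp1, one_mul] at h2
  linarith

omit hΛ in
lemma wd_inv_act (g : SL2) (v w : E2) : wd (toEuc g⁻¹ v) w = - wd (toEuc g w) v := by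
  have h := wd_act g (toEuc g⁻¹ v) w
  rw [toEuc_inv_apply] at h
  rw [← h]; unfold wd; ring

end means

lemma dichotomy {κ : ℕ} {p : Fin κ → ℝ} (hp : ∀ i, 0 < p i) (hp1 : ∑ i, p i = 1)
    (A : Fin κ → SL2) (hL : 0 < lyapLC p A) (hS : ¬ StarC p A) :
    ∃ v : E2, v ≠ 0 ∧ ∀ i, wd (toEuc (A i) v) v = 0 := by
  obtain ⟨Λ, hΛ⟩ := exists_mean hp hp1 A hS
  obtain ⟨v, hv, hvh⟩ := exists_half hΛ hp hp1 hL
  have hvm : 1 / 2 ≤ mass Λ v := le_ciInf fun k => hvh _ (by positivity)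
  have hpar : ∀ w : E2, w ≠ 0 → ∀ u : E2, u ≠ 0 → wd w u = 0 → mass Λ w = mass Λ u := by
    intro w hw u hu h
    obtain ⟨c, rfl⟩ := parallel_of_wd hu h
    refine mass_smul u ?_
    rintro rfl; simp at hw
  by_cases hone : ∀ w : E2, w ≠ 0 → 1 / 2 ≤ mass Λ w → wd w v = 0
  · have hmax : ∀ w : E2, w ≠ 0 → mass Λ w ≤ mass Λ v := by
      intro w hw
      by_contra hlt
      push Not at hlt
      have := hpar w hw v hv (hone w hw (by linarith))
      linarith
    refine ⟨v, hv, fun i => ?_⟩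
    have h1 := mass_max hΛ hp hp1 hv hmax i
    have h2 := hone _ (act_ne_zero (A i)⁻¹ hv) (by rw [h1]; exact hvm)
    rw [wd_inv_act] at h2
    linarith
  · push Not at hone
    obtain ⟨v', hv', hvm', hD⟩ := hone
    have hD' : wd v v' ≠ 0 := by
      have : wd v v' = - wd v' v := by unfold wd; ring
      rw [this]; exact neg_ne_zero.2 hD
    have htwo := mass_two hΛ hD
    have e1 : mass Λ v = 1 / 2 := by linarith
    have e2 : mass Λ v' = 1 / 2 := by linarith
    have hcl : ∀ w : E2, w ≠ 0 → wd w v = 0 ∨ wd w v' = 0 ∨ mass Λ w ≤ 0 := by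
      intro w hw
      by_cases a : wd w v = 0
      · exact Or.inl a
      by_cases b : wd w v' = 0
      · exact Or.inr (Or.inl b)
      have := mass_three hΛ a b hD'
      exact Or.inr (Or.inr (by linarith))
    have hmax : ∀ w : E2, w ≠ 0 → mass Λ w ≤ 1 / 2 := by
      intro w hw
      rcases hcl w hw with a | a | a
      · rw [hpar w hw v hv a, e1]
      · rw [hpar w hw v' hv' a, e2]
      · linarith
    have hcase : ∀ (u : E2), u ≠ 0 → mass Λ u = 1 / 2 → ∀ i,
        wd (toEuc (A i)⁻¹ u) v = 0 ∨ wd (toEuc (A i)⁻¹ u) v' = 0 := by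
      intro u hu hum i
      have h1 := mass_max hΛ hp hp1 hu (fun w hw => by rw [hum]; exact hmax w hw) i
      rcases hcl _ (act_ne_zero (A i)⁻¹ hu) with a | a | a
      · exact Or.inl a
      · exact Or.inr a
      · rw [h1, hum] at a; norm_num at a
    have hnp : ∀ i, ∀ u : E2, u ≠ 0 → wd (toEuc (A i)⁻¹ v) u = 0 →
        wd (toEuc (A i)⁻¹ v') u = 0 → False := by
      intro i u hu a b
      obtain ⟨c, hc⟩ := parallel_of_wd hu a
      obtain ⟨d, hd⟩ := parallel_of_wd hu b
      have := wd_act (A i)⁻¹ v v'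
      rw [hc, hd] at this
      apply hD'
      rw [← this]
      simp [wd]; ring
    have hall : ∀ i, (wd (toEuc (A i) v) v = 0 ∧ wd (toEuc (A i) v') v' = 0) ∨
        (wd (toEuc (A i) v) v' = 0 ∧ wd (toEuc (A i) v') v = 0) := by
      intro i
      rcases hcase v hv e1 i with a | a <;> rcases hcase v' hv' e2 i with b | b
      · exact (hnp i v hv a b).elim
      · rw [wd_inv_act, neg_eq_zero] at a b
        exact Or.inl ⟨a, b⟩
      · rw [wd_inv_act, neg_eq_zero] at a b
        exact Or.inr ⟨b, a⟩
      · exact (hnp i v' hv' a b).elim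
    by_cases hsw : ∀ i, wd (toEuc (A i) v) v = 0 ∧ wd (toEuc (A i) v') v' = 0
    · exact ⟨v, hv, fun i => (hsw i).1⟩
    · push Not at hsw
      obtain ⟨i₀, hi₀⟩ := hsw
      have := swap_case hp hp1 A hD' hall i₀ (fun h => hi₀ h.1 h.2)
      linarith
/-- **Peres' theorem.** If `L(p,A) > 0` (all `p_i > 0`), then on some neighborhood of
`p` inside the open simplex of probability vectors, the map `q ↦ L(q,A)` is real
analytic: it agrees there with a function analytic on an ambient open set. -/
theorem peres_analyticity {κ : ℕ} (hκ : 2 ≤ κ) (A : Fin κ → SL2)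
    (p : Fin κ → ℝ) (hp : ∀ i, 0 < p i) (hp1 : ∑ i, p i = 1)
    (hL : 0 < lyapLC p A) :
    ∃ U : Set (Fin κ → ℝ), IsOpen U ∧ p ∈ U ∧
      ∃ F : (Fin κ → ℝ) → ℝ, AnalyticOnNhd ℝ F U ∧
        ∀ q ∈ U, (∀ i, 0 < q i) → ∑ i, q i = 1 → F q = lyapLC q A := by
  by_cases hS : StarC p A
  · obtain ⟨U, hU, hpU, F, hF, h⟩ := star_analytic hp hp1 A hS
    refine ⟨U, hU, hpU, F, hF, fun q hq hq0 hq1 => ?_⟩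
    obtain ⟨C, hC⟩ := h q hq hq0 hq1
    exact lyap_eq_of_bound hq0 hq1 A hC
  · obtain ⟨v, hv, hfix⟩ := dichotomy hp hp1 A hL hS
    choose a ha using fun i => parallel_of_wd hv (hfix i)
    have ha0 : ∀ i, a i ≠ 0 := by
      intro i h0
      have h1 := ha i
      rw [h0, zero_smul] at h1
      exact act_ne_zero (A i) hv h1
    have hl : ∀ q : Fin κ → ℝ, (∀ i, 0 < q i) → ∑ i, q i = 1 →
        lyapLC q A = |∑ i, q i * Real.log (|a i|)| := fun q hq hq1 =>
      line_case hq hq1 A hv a ha0 ha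
    have hc : Continuous fun q : Fin κ → ℝ => ∑ i, q i * Real.log (|a i|) := by fun_prop
    have han : ∀ q : Fin κ → ℝ,
        AnalyticAt ℝ (fun q : Fin κ → ℝ => ∑ i, q i * Real.log (|a i|)) q := by
      intro q
      refine Finset.analyticAt_fun_sum _ fun i _ => ?_
      exact ((ContinuousLinearMap.proj (R := ℝ) (φ := fun _ : Fin κ => ℝ) i).analyticAt q).mul
        analyticAt_const
    have hne : ∑ i, p i * Real.log (|a i|) ≠ 0 := by
      intro h0
      rw [hl p hp hp1, h0, abs_zero] at hL
      exact lt_irrefl _ hL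
    rcases lt_or_gt_of_ne hne with hneg | hpos
    · refine ⟨{q | ∑ i, q i * Real.log (|a i|) < 0}, isOpen_lt hc continuous_const, hneg,
        fun q => - ∑ i, q i * Real.log (|a i|), fun q _ => (han q).neg, fun q hq hq0 hq1 => ?_⟩
      rw [hl q hq0 hq1, abs_of_neg hq]
    · refine ⟨{q | 0 < ∑ i, q i * Real.log (|a i|)}, isOpen_lt continuous_const hc, hpos,
        fun q => ∑ i, q i * Real.log (|a i|), fun q _ => han q, fun q hq hq0 hq1 => ?_⟩
      rw [hl q hq0 hq1, abs_of_pos hq]
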